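/- arXiv:2309.08801 — 11 statements merged into one kernel-verified Lean document; each statement's English description precedes it below -/
import Mathlib

section
/- Assume all entries of A and b are rational. Let conv(X) denote the convex hull of X and Y_CH = {Cy : y ∈ conv(X)}. If the convex hull relaxation has an efficient solution, i.e., there exists x̄ ∈ conv(X) with Cx̄ ∈ Max(Y_CH), then it has an integral efficient solution: there exists x* ∈ X with Cx* ∈ Max(Y_CH). -/
namespace Stmt4

/-- Nondominated (from above) points of a subset of ℝ^k. -/
def ParetoMax {k : ℕ} (S : Set (Fin k → ℝ)) : Set (Fin k → ℝ) :=
  {s ∈ S | ¬ ∃ t ∈ S, s ≤ t ∧ s ≠ t}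

/-- A point of a convex hull gives positive weight to some generator, and the part of the
convex combination carried by that generator may be moved to any other point of the hull. -/
theorem exists_generator_exchange {E : Type*} [AddCommGroup E] [Module ℝ E] {s : Set E} {x : E}
    (hx : x ∈ convexHull ℝ s) :
    ∃ z ∈ s, ∃ c : ℝ, 0 < c ∧ ∀ y ∈ convexHull ℝ s, x + c • (y - z) ∈ convexHull ℝ s := by
  classical
  obtain ⟨ι, _, w, z, hw, hw1, hz, rfl⟩ := mem_convexHull_iff_exists_fintype.1 hx
  obtain ⟨i, -, hi⟩ : ∃ i ∈ Finset.univ, 0 < w i :=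
    Finset.exists_lt_of_sum_lt (f := fun _ => (0 : ℝ)) (by simp [hw1])
  refine ⟨z i, hz i, w i, hi, fun y hy => ?_⟩
  have hsum : ∑ j, w j • z j + w i • (y - z i) = ∑ j, w j • Function.update z i y j := by
    rw [← Finset.add_sum_erase _ _ (Finset.mem_univ i),
      ← Finset.add_sum_erase _ (fun j => w j • Function.update z i y j) (Finset.mem_univ i),
      Finset.sum_congr rfl fun j hj => by
        rw [← Function.update_of_ne (Finset.ne_of_mem_erase hj) y z]]
    simp only [Function.update_self]
    module
  rw [hsum]
  refine (convex_convexHull ℝ s).sum_mem (fun j _ => hw j) hw1 fun j _ => ?_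
  obtain rfl | hj := eq_or_ne j i
  · simpa using hy
  · simpa [hj] using subset_convexHull ℝ s (hz j)

/-- With rational data, if the convex hull relaxation has an efficient solution then it
has an integral efficient solution. -/
theorem ch_has_integral_efficient {k m n : ℕ}
    (A : Matrix (Fin m) (Fin n) ℝ) (b : Fin m → ℝ) (C : Matrix (Fin k) (Fin n) ℝ)
    (hArat : ∀ i j, ∃ q : ℚ, A i j = (q : ℝ)) (hbrat : ∀ i, ∃ q : ℚ, b i = (q : ℝ))
    (X : Set (Fin n → ℝ))
    (hX : X = {x | (∀ j, ∃ N : ℕ, x j = (N : ℝ)) ∧ A.mulVec x ≤ b})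
    (YCH : Set (Fin k → ℝ))
    (hYCH : YCH = (fun x => C.mulVec x) '' (convexHull ℝ X))
    (hex : ∃ xbar ∈ convexHull ℝ X, C.mulVec xbar ∈ ParetoMax YCH) :
    ∃ xstar ∈ X, C.mulVec xstar ∈ ParetoMax YCH := by
  subst hYCH
  obtain ⟨x, hx, -, hmax⟩ := hex
  obtain ⟨z, hz, c, hc, hexch⟩ := exists_generator_exchange hx
  refine ⟨z, hz, ⟨z, subset_convexHull ℝ X hz, rfl⟩, ?_⟩
  rintro ⟨_, ⟨y, hy, rfl⟩, hle, hne⟩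
  refine hmax ⟨_, ⟨_, hexch y hy, rfl⟩, ?_⟩
  simp only [Matrix.mulVec_add, Matrix.mulVec_smul, Matrix.mulVec_sub]
  refine ⟨le_add_of_nonneg_right (smul_nonneg hc.le (sub_nonneg.2 hle)), fun h => hne ?_⟩
  have hzero : c • (C.mulVec y - C.mulVec z) = 0 := left_eq_add.1 h
  exact (sub_eq_zero.1 ((smul_eq_zero.1 hzero).resolve_left hc.ne')).symm

end Stmt4
end

section
/- Assume all entries of A and b are rational. Let conv(X) denote the convex hull of X and Y_CH = {Cy : y ∈ conv(X)}, and let x* be an efficient solution of the MOIP, i.e., x* ∈ X and Cx* ∈ Max(Y). Then x* is a supported solution if and only if x* is an efficient solution of the convex hull relaxation, i.e., Cx* ∈ Max(Y_CH). -/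
open Matrix

namespace Stmt5

/-- Nondominated (from above) points of a subset of ℝ^k. -/
def ParetoMax {k : ℕ} (S : Set (Fin k → ℝ)) : Set (Fin k → ℝ) :=
  {s ∈ S | ¬ ∃ t ∈ S, s ≤ t ∧ s ≠ t}

/-- **Farkas' lemma** for a finite family of linear functionals. -/
theorem exists_nonneg_combination_of_forall_nonpos {ι V : Type*} [AddCommGroup V] [Module ℝ V]
    (s : Finset ι) (a : ι → V →ₗ[ℝ] ℝ) (b : V →ₗ[ℝ] ℝ)
    (h : ∀ x, (∀ i ∈ s, a i x ≤ 0) → b x ≤ 0) :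
    ∃ c : ι → ℝ, (∀ i, 0 ≤ c i) ∧ b = ∑ i ∈ s, c i • a i := by
  classical
  induction s using Finset.induction_on generalizing a b with
  | empty =>
    refine ⟨0, fun _ => le_rfl, ?_⟩
    ext x
    have h1 := h x (by simp)
    have h2 := h (-x) (by simp)
    simp only [map_neg] at h2
    simp only [Finset.sum_empty, LinearMap.zero_apply]
    linarith
  | insert j s hj ih =>
    by_cases hs : ∀ x, (∀ i ∈ s, a i x ≤ 0) → b x ≤ 0
    · obtain ⟨c, hc, hb⟩ := ih a b hs
      refine ⟨Function.update c j 0, fun i => ?_, ?_⟩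
      · by_cases hi : i = j
        · simp [hi]
        · simp [hi, hc i]
      · rw [Finset.sum_insert hj, hb]
        simp only [Function.update_self, zero_smul, zero_add]
        refine Finset.sum_congr rfl fun i hi => ?_
        rw [Function.update_of_ne (ne_of_mem_of_not_mem hi hj)]
    · push Not at hs
      obtain ⟨x₀, hx₀, hbx₀⟩ := hs
      have hjx₀ : 0 < a j x₀ := by
        by_contra hle
        refine hbx₀.not_ge (h x₀ fun i hi => ?_)
        rcases Finset.mem_insert.mp hi with rfl | hi
        · exact not_lt.mp hle
        · exact hx₀ i hi
      have hne := hjx₀.ne'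
      obtain ⟨c, hc, hb⟩ := ih (fun i => a i - (a i x₀ / a j x₀) • a j)
        (b - (b x₀ / a j x₀) • a j) (fun x hx => by
          have key := h (x - (a j x / a j x₀) • x₀) (fun i hi => by
            rcases Finset.mem_insert.mp hi with rfl | hi
            · simp [hne]
            · have := hx i hi
              simp only [LinearMap.sub_apply, LinearMap.smul_apply, map_sub, map_smul,
                smul_eq_mul] at this ⊢
              linarith [div_mul_comm (a i x₀) (a j x₀) (a j x)])
          simp only [LinearMap.sub_apply, LinearMap.smul_apply, map_sub, map_smul,
            smul_eq_mul] at key ⊢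
          linarith [div_mul_comm (b x₀) (a j x₀) (a j x)])
      set d : ℝ := (b x₀ - ∑ i ∈ s, c i * a i x₀) / a j x₀ with hd
      have hd0 : 0 ≤ d := by
        refine div_nonneg ?_ hjx₀.le
        have : ∑ i ∈ s, c i * a i x₀ ≤ 0 :=
          Finset.sum_nonpos fun i hi => mul_nonpos_of_nonneg_of_nonpos (hc i) (hx₀ i hi)
        linarith
      refine ⟨Function.update c j d, fun i => ?_, ?_⟩
      · by_cases hi : i = j
        · simp [hi, hd0]
        · simp [hi, hc i]
      · have hsum : ∑ i ∈ s, Function.update c j d i • a i = ∑ i ∈ s, c i • a i :=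
          Finset.sum_congr rfl fun i hi => by
            rw [Function.update_of_ne (ne_of_mem_of_not_mem hi hj)]
        rw [Finset.sum_insert hj, hsum, Function.update_self]
        ext x
        have hbx := LinearMap.congr_fun hb x
        simp only [LinearMap.sub_apply, LinearMap.smul_apply, LinearMap.add_apply,
          LinearMap.sum_apply, smul_eq_mul, mul_sub, Finset.sum_sub_distrib] at hbx ⊢
        have hfac : ∑ i ∈ s, c i * (a i x₀ / a j x₀ * a j x)
            = (∑ i ∈ s, c i * a i x₀) / a j x₀ * a j x := by
          rw [Finset.sum_div, Finset.sum_mul]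
          exact Finset.sum_congr rfl fun i _ => by ring
        rw [hfac] at hbx
        rw [hd, sub_div, sub_mul]
        linarith

/-- Tucker's theorem of the alternative: if no nonnegative combination of finitely many vectors
is a nonzero nonnegative vector, then some positive vector has nonpositive product with each. -/
theorem exists_pos_dotProduct_nonpos {ι : Type*} {k : ℕ} (s : Finset ι) (w : ι → Fin k → ℝ)
    (h : ∀ c : ι → ℝ, (∀ i, 0 ≤ c i) → 0 ≤ ∑ i ∈ s, c i • w i → ∑ i ∈ s, c i • w i = 0) :
    ∃ μ : Fin k → ℝ, (∀ p, 0 < μ p) ∧ ∀ i ∈ s, μ ⬝ᵥ w i ≤ 0 := by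
  classical
  have hcoord : ∀ p : Fin k, ∃ μ : Fin k → ℝ, 0 ≤ μ ∧ 0 < μ p ∧ ∀ i ∈ s, μ ⬝ᵥ w i ≤ 0 := by
    intro p
    by_contra hcon
    push Not at hcon
    let pr : Fin k → (Fin k → ℝ) →ₗ[ℝ] ℝ := fun q => LinearMap.proj q
    let dp : ι → (Fin k → ℝ) →ₗ[ℝ] ℝ := fun i => ∑ q, w i q • pr q
    have hdp : ∀ i μ, dp i μ = μ ⬝ᵥ w i := fun i μ => by
      simp [dp, pr, dotProduct, mul_comm]
    obtain ⟨c, hc, hb⟩ := exists_nonneg_combination_of_forall_nonpos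
      (s.disjSum (Finset.univ : Finset (Fin k))) (Sum.elim dp fun q => -pr q) (pr p)
      (fun μ hμ => by
        by_contra hpos
        obtain ⟨i, hi, hlt⟩ := hcon μ
          (fun q => by simpa [pr] using hμ (Sum.inr q) (by simp))
          (by simpa [pr] using hpos)
        have := hμ (Sum.inl i) (by simpa using hi)
        simp only [Sum.elim_inl, hdp] at this
        linarith)
    have hval : ∀ q, (∑ i ∈ s, c (Sum.inl i) • w i) q
        = (Pi.single p 1 : Fin k → ℝ) q + c (Sum.inr q) := by
      intro q
      have := LinearMap.congr_fun hb (Pi.single q 1)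
      simp only [Finset.sum_disjSum, LinearMap.add_apply, LinearMap.sum_apply,
        LinearMap.smul_apply, Sum.elim_inl, Sum.elim_inr, hdp, LinearMap.neg_apply, pr,
        LinearMap.proj_apply, smul_eq_mul, single_one_dotProduct] at this
      simp only [Finset.sum_apply, Pi.smul_apply, smul_eq_mul]
      simp [Pi.single_apply] at this ⊢
      simp only [eq_comm (a := q)]
      linarith
    have hz := h (fun i => c (Sum.inl i)) (fun i => hc _) (fun q => by
      rw [hval q]
      refine add_nonneg ?_ (hc _)
      by_cases hq : q = p
      · subst hq; simp
      · simp [hq])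
    have := hval p
    rw [hz] at this
    simp only [Pi.zero_apply, Pi.single_eq_same] at this
    linarith [hc (Sum.inr p)]
  choose μ hμ0 hμp hμs using hcoord
  refine ⟨∑ p, μ p, fun p => ?_, fun i hi => ?_⟩
  · rw [Finset.sum_apply]
    exact Finset.sum_pos' (fun q _ => hμ0 q p) ⟨p, Finset.mem_univ p, hμp p⟩
  · rw [sum_dotProduct]
    exact Finset.sum_nonpos fun p _ => hμs p i hi

/-- A fibre of a homomorphism out of a well-quasi-ordered cancellative monoid is generated by
finitely many of its points together with finitely many elements of the kernel. -/
theorem exists_finset_generating_fiber {M N : Type*} [AddCommMonoid M] [PartialOrder M]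
    [WellQuasiOrderedLE M] [IsOrderedCancelAddMonoid M] [CanonicallyOrderedAdd M]
    [AddCommGroup N] (f : M →+ N) (d : N) :
    ∃ V R : Finset M, (∀ v ∈ V, f v = d) ∧ (∀ r ∈ R, f r = 0) ∧
      ∀ x, f x = d → ∃ v ∈ V, ∃ g ∈ AddSubmonoid.closure (R : Set M), x = v + g := by
  obtain ⟨R, hR⟩ := AddSubmonoid.fg_eqLocusM f 0
  have hpwo := Set.isPWO_of_wellQuasiOrderedLE {x | f x = d}
  have hfin : {x | Minimal (· ∈ {x | f x = d}) x}.Finite :=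
    (setOfPred_minimal_antichain _).finite_of_partiallyWellOrderedOn
      (hpwo.mono (setOfPred_minimal_subset _))
  refine ⟨hfin.toFinset, R, fun v hv => ?_, fun r hr => ?_, fun x hx => ?_⟩
  · exact (hfin.mem_toFinset.mp hv).1
  · have : r ∈ f.eqLocusM 0 := hR ▸ AddSubmonoid.subset_closure hr
    exact this
  · obtain ⟨v, hvx, hv⟩ := hpwo.exists_le_minimal (a := x) hx
    obtain ⟨g, rfl⟩ := exists_add_of_le hvx
    refine ⟨v, hfin.mem_toFinset.mpr hv, g, ?_, rfl⟩
    rw [hR]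
    have h1 : f v = d := hv.1
    have h2 : f v + f g = d := by rw [← map_add]; exact hx
    show f g = 0
    rw [h1] at h2
    simpa using h2

/-- Finitely many rationals have a common positive denominator. -/
theorem exists_common_denominator {ι : Type*} [Fintype ι] (q : ι → ℚ) :
    ∃ D : ℕ, 0 < D ∧ ∀ i, ∃ z : ℤ, (D : ℚ) * q i = z := by
  refine ⟨∏ i, (q i).den, Finset.prod_pos fun i _ => (q i).den_pos, fun i => ?_⟩
  obtain ⟨e, he⟩ := Finset.dvd_prod_of_mem (fun i => (q i).den) (Finset.mem_univ i)
  refine ⟨e * (q i).num, ?_⟩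
  rw [he]
  push_cast
  linear_combination (e : ℚ) * Rat.den_mul_eq_num (q i)

/-- A rational linear system can be replaced by an equivalent integer one. -/
theorem exists_integer_system {m n : ℕ} (A : Matrix (Fin m) (Fin n) ℝ) (b : Fin m → ℝ)
    (hA : ∀ i j, ∃ q : ℚ, A i j = (q : ℝ)) (hb : ∀ i, ∃ q : ℚ, b i = (q : ℝ)) :
    ∃ (A' : Matrix (Fin m) (Fin n) ℤ) (b' : Fin m → ℤ), ∀ x : Fin n → ℕ,
      A.mulVec (fun j => (x j : ℝ)) ≤ b ↔ ∀ i, ∑ j, A' i j * (x j : ℤ) ≤ b' i := by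
  choose qA hqA using hA
  choose qb hqb using hb
  obtain ⟨D, hD, hz⟩ := exists_common_denominator
    (Sum.elim (fun p : Fin m × Fin n => qA p.1 p.2) qb)
  choose z hz using hz
  have hzA : ∀ i j, (D : ℝ) * A i j = z (Sum.inl (i, j)) := fun i j => by
    rw [hqA]; exact_mod_cast hz (Sum.inl (i, j))
  have hzb : ∀ i, (D : ℝ) * b i = z (Sum.inr i) := fun i => by
    rw [hqb]; exact_mod_cast hz (Sum.inr i)
  refine ⟨fun i j => z (Sum.inl (i, j)), fun i => z (Sum.inr i), fun x => ?_⟩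
  rw [Pi.le_def]
  refine forall_congr' fun i => ?_
  have hD' : (0 : ℝ) < D := by exact_mod_cast hD
  rw [← mul_le_mul_iff_right₀ hD', hzb, ← Int.cast_le (R := ℝ)]
  push_cast
  simp only [mulVec, dotProduct, Finset.mul_sum, ← hzA, mul_assoc]

/-- The maximality of a feasible point for a linear functional over the integer points of a
rational polyhedron is witnessed by finitely many feasible points. -/
theorem exists_finset_testing_maximality {m n : ℕ} (A : Matrix (Fin m) (Fin n) ℝ) (b : Fin m → ℝ)
    (hA : ∀ i j, ∃ q : ℚ, A i j = (q : ℝ)) (hb : ∀ i, ∃ q : ℚ, b i = (q : ℝ))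
    (X : Set (Fin n → ℝ))
    (hX : X = {x | (∀ j, ∃ N : ℕ, x j = (N : ℝ)) ∧ A.mulVec x ≤ b})
    (y : Fin n → ℝ) (hy : y ∈ X) :
    ∃ F : Finset (Fin n → ℝ), (∀ x ∈ F, x ∈ X) ∧
      ∀ φ : (Fin n → ℝ) →ₗ[ℝ] ℝ, (∀ x ∈ F, φ x ≤ φ y) → ∀ x ∈ X, φ x ≤ φ y := by
  classical
  obtain ⟨A', b', hsys⟩ := exists_integer_system A b hA hb
  let f : (Fin n → ℕ) × (Fin m → ℕ) →+ (Fin m → ℤ) :=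
    { toFun := fun p i => ∑ j, A' i j * (p.1 j : ℤ) + p.2 i
      map_zero' := by ext i; simp
      map_add' := fun p q => by
        ext i
        simp only [Prod.fst_add, Prod.snd_add, Pi.add_apply, Nat.cast_add, mul_add,
          Finset.sum_add_distrib]
        ring }
  let e : (Fin n → ℕ) × (Fin m → ℕ) →+ (Fin n → ℝ) :=
    { toFun := fun p j => (p.1 j : ℝ)
      map_zero' := by ext i; simp
      map_add' := fun p q => by ext i; simp }
  have hmem : ∀ p, f p = b' → e p ∈ X := fun p hp => by
    rw [hX]
    refine ⟨fun j => ⟨p.1 j, rfl⟩, (hsys p.1).mpr fun i => ?_⟩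
    have : ∑ j, A' i j * (p.1 j : ℤ) + p.2 i = b' i := congrFun hp i
    linarith [Int.natCast_nonneg (p.2 i)]
  have hlift : ∀ x ∈ X, ∃ p, f p = b' ∧ e p = x := fun x hx => by
    rw [hX] at hx
    obtain ⟨hN, hx⟩ := hx
    choose N hN using hN
    obtain rfl : x = fun j => (N j : ℝ) := funext hN
    have hle := (hsys N).mp hx
    refine ⟨(N, fun i => (b' i - ∑ j, A' i j * (N j : ℤ)).toNat), ?_, rfl⟩
    ext i
    show ∑ j, A' i j * (N j : ℤ) + ((b' i - ∑ j, A' i j * (N j : ℤ)).toNat : ℤ) = b' i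
    rw [Int.toNat_of_nonneg (sub_nonneg.mpr (hle i))]
    ring
  obtain ⟨V, R, hV, hR, hgen⟩ := exists_finset_generating_fiber f b'
  obtain ⟨p, hp, hpy⟩ := hlift y hy
  refine ⟨V.image e ∪ R.image fun r => e (p + r), fun x hx => ?_, fun φ hφ x hx => ?_⟩
  · rcases Finset.mem_union.mp hx with hx | hx
    · obtain ⟨v, hv, rfl⟩ := Finset.mem_image.mp hx
      exact hmem v (hV v hv)
    · obtain ⟨r, hr, rfl⟩ := Finset.mem_image.mp hx
      exact hmem _ (by rw [map_add, hp, hR r hr, add_zero])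
  · have hray : ∀ g ∈ AddSubmonoid.closure (R : Set ((Fin n → ℕ) × (Fin m → ℕ))),
        φ (e g) ≤ 0 := fun g hg => by
      induction hg using AddSubmonoid.closure_induction with
      | mem r hr =>
        have := hφ _ (Finset.mem_union_right _ (Finset.mem_image_of_mem _ hr))
        rw [map_add, map_add, hpy] at this
        linarith
      | zero => simp
      | add g g' _ _ h h' =>
        rw [map_add, map_add]
        linarith
    obtain ⟨u, hu, rfl⟩ := hlift x hx
    obtain ⟨v, hv, g, hg, rfl⟩ := hgen u hu
    have h1 := hφ _ (Finset.mem_union_left _ (Finset.mem_image_of_mem e hv))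
    have h2 := hray g hg
    rw [map_add, map_add]
    linarith

/-- A positive weight vector strictly increases along the Pareto order. -/
theorem dotProduct_lt_dotProduct_of_pos {k : ℕ} {μ s t : Fin k → ℝ} (hμ : ∀ i, 0 < μ i)
    (hst : s ≤ t) (hne : s ≠ t) : μ ⬝ᵥ s < μ ⬝ᵥ t := by
  obtain ⟨_, i, hi⟩ := Pi.lt_def.mp (lt_of_le_of_ne hst hne)
  exact Finset.sum_lt_sum (fun j _ => mul_le_mul_of_nonneg_left (hst j) (hμ j).le)
    ⟨i, Finset.mem_univ i, mul_lt_mul_of_pos_left hi (hμ i)⟩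

/-- If the image of `y` is nondominated in the image of a convex set, no nonnegative combination
of differences from `y` has a nonzero nonnegative image. -/
theorem sum_smul_mulVec_sub_eq_zero {k n : ℕ} (C : Matrix (Fin k) (Fin n) ℝ)
    {K : Set (Fin n → ℝ)} (hK : Convex ℝ K) {y : Fin n → ℝ} (hy : y ∈ K)
    (hmax : C.mulVec y ∈ ParetoMax ((fun x => C.mulVec x) '' K))
    (F : Finset (Fin n → ℝ)) (hF : ∀ x ∈ F, x ∈ K) (c : (Fin n → ℝ) → ℝ) (hc : ∀ x, 0 ≤ c x)
    (hnonneg : 0 ≤ ∑ x ∈ F, c x • C.mulVec (x - y)) :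
    ∑ x ∈ F, c x • C.mulVec (x - y) = 0 := by
  set d := ∑ x ∈ F, c x • C.mulVec (x - y) with hd
  set S := ∑ x ∈ F, c x with hS
  have hS0 : 0 ≤ S := Finset.sum_nonneg fun x _ => hc x
  have hT : 0 < 1 + S := by linarith
  have hdC : d = C.mulVec (∑ x ∈ F, c x • (x - y)) := by
    rw [hd, mulVec_sum]
    exact Finset.sum_congr rfl fun x _ => (mulVec_smul ..).symm
  have hzK : y + (1 + S)⁻¹ • ∑ x ∈ F, c x • (x - y) ∈ K := by
    rcases hS0.eq_or_lt with h0 | hpos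
    · have : ∀ x ∈ F, c x = 0 :=
        (Finset.sum_eq_zero_iff_of_nonneg fun x _ => hc x).mp h0.symm
      rw [Finset.sum_eq_zero fun x hx => by rw [this x hx, zero_smul]]
      simpa using hy
    · have hcm := hK.centerMass_mem (t := F) (w := c) (z := id) (fun x _ => hc x) hpos hF
      have := hK hy hcm (a := (1 + S)⁻¹) (b := (1 + S)⁻¹ * S) (by positivity) (by positivity)
        (by field_simp)
      convert this using 1
      simp only [Finset.centerMass, id, smul_sub, Finset.sum_sub_distrib, ← Finset.sum_smul,
        ← hS, smul_smul]
      rw [mul_assoc, mul_inv_cancel₀ hpos.ne', mul_one]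
      have : y = ((1 + S)⁻¹ + (1 + S)⁻¹ * S) • y := by
        rw [show (1 + S)⁻¹ + (1 + S)⁻¹ * S = 1 by field_simp, one_smul]
      nth_rewrite 1 [this]
      rw [add_smul]
      abel
  by_contra hne
  refine hmax.2 ⟨_, ⟨_, hzK, rfl⟩, ?_, ?_⟩
  · simp only [mulVec_add, mulVec_smul, ← hdC]
    exact le_add_of_nonneg_right (smul_nonneg (by positivity) hnonneg)
  · simp only [mulVec_add, mulVec_smul, ← hdC]
    intro heq
    exact (smul_ne_zero (inv_ne_zero hT.ne') hne) (left_eq_add.mp heq)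

/-- With rational data, an efficient solution of the MOIP is supported if and only if it is
an efficient solution of the convex hull relaxation. -/
theorem supported_iff_ch_efficient {k m n : ℕ}
    (A : Matrix (Fin m) (Fin n) ℝ) (b : Fin m → ℝ) (C : Matrix (Fin k) (Fin n) ℝ)
    (hArat : ∀ i j, ∃ q : ℚ, A i j = (q : ℝ)) (hbrat : ∀ i, ∃ q : ℚ, b i = (q : ℝ))
    (X : Set (Fin n → ℝ))
    (hX : X = {x | (∀ j, ∃ N : ℕ, x j = (N : ℝ)) ∧ A.mulVec x ≤ b})
    (Y YCH : Set (Fin k → ℝ))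
    (hY : Y = (fun x => C.mulVec x) '' X)
    (hYCH : YCH = (fun x => C.mulVec x) '' (convexHull ℝ X))
    (xstar : Fin n → ℝ) (hxmem : xstar ∈ X) (heff : C.mulVec xstar ∈ ParetoMax Y) :
    (∃ μ : Fin k → ℝ, (∀ i, 0 < μ i) ∧
        ∀ x ∈ X, μ ⬝ᵥ C.mulVec x ≤ μ ⬝ᵥ C.mulVec xstar)
      ↔ C.mulVec xstar ∈ ParetoMax YCH := by
  have hxhull : xstar ∈ convexHull ℝ X := subset_convexHull ℝ X hxmem
  let φ : (Fin k → ℝ) → (Fin n → ℝ) →ₗ[ℝ] ℝ := fun μ =>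
    { toFun := fun x => μ ⬝ᵥ C.mulVec x
      map_add' := fun x y => by rw [mulVec_add, dotProduct_add]
      map_smul' := fun r x => by simp [mulVec_smul] }
  subst hYCH
  constructor
  · rintro ⟨μ, hμ, hsup⟩
    refine ⟨⟨xstar, hxhull, rfl⟩, ?_⟩
    rintro ⟨_, ⟨y, hy, rfl⟩, hle, hne⟩
    have hyle : φ μ y ≤ φ μ xstar :=
      convexHull_min (t := {x | φ μ x ≤ φ μ xstar}) hsup
        (convex_halfSpace_le (φ μ).isLinear _) hy
    exact (dotProduct_lt_dotProduct_of_pos hμ hle hne).not_ge hyle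
  · intro hmax
    obtain ⟨F, hFX, hF⟩ := exists_finset_testing_maximality A b hArat hbrat X hX xstar hxmem
    obtain ⟨μ, hμ, hμF⟩ := exists_pos_dotProduct_nonpos F (fun x => C.mulVec (x - xstar))
      (sum_smul_mulVec_sub_eq_zero C (convex_convexHull ℝ X) hxhull hmax F
        fun x hx => subset_convexHull ℝ X (hFX x hx))
    refine ⟨μ, hμ, hF (φ μ) fun x hx => ?_⟩
    have : φ μ (x - xstar) ≤ 0 := hμF x hx
    rw [map_sub] at this
    linarith

end Stmt5
end

section
/- Let Λ ∈ ℝ^{k×m₁} have nonnegative entries. Assume Max(Y) is nonempty and that every element of Y_{LR(Λ)} is dominated by some element of Max(Y_{LR(Λ)}), i.e., for each y ∈ Y_{LR(Λ)} there is z ∈ Max(Y_{LR(Λ)}) with y ≤ z (this holds, e.g., when Y_{LR(Λ)} is closed and bounded above). Then Max(Y) ⪯ Max(Y_{LR(Λ)}). -/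
namespace Stmt6

/-- Nondominated (from above) points of a subset of ℝ^k. -/
def ParetoMax {k : ℕ} (S : Set (Fin k → ℝ)) : Set (Fin k → ℝ) :=
  {s ∈ S | ¬ ∃ t ∈ S, s ≤ t ∧ s ≠ t}

/-- The Pareto set-ordering `S ⪯ T`. -/
def SetPrec {k : ℕ} (S T : Set (Fin k → ℝ)) : Prop :=
  (∀ s ∈ S, ∃ t ∈ T, s ≤ t) ∧ ∀ s ∈ S, ∀ t ∈ T, ¬(t ≤ s ∧ t ≠ s)

/-- To compare a set with a set of nondominated points, it suffices to bound each of its points. -/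
lemma SetPrec.of_forall_exists_le {k : ℕ} {S T : Set (Fin k → ℝ)}
    (h : ∀ s ∈ S, ∃ t ∈ ParetoMax T, s ≤ t) : SetPrec S (ParetoMax T) := by
  refine ⟨h, fun s hs t ht ⟨hts, hne⟩ => ?_⟩
  obtain ⟨z, hz, hsz⟩ := h s hs
  exact ht.2 ⟨z, hz.1, hts.trans hsz, fun htz => hne (hts.antisymm (htz ▸ hsz))⟩

lemma mulVec_nonneg_of_nonneg {k m : ℕ} {M : Matrix (Fin k) (Fin m) ℝ} (hM : ∀ i j, 0 ≤ M i j)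
    {v : Fin m → ℝ} (hv : 0 ≤ v) : 0 ≤ M.mulVec v :=
  fun i => dotProduct_nonneg_of_nonneg (hM i) hv

/-- The Lagrangian relaxation yields an upper bound set: `Max(Y) ⪯ Max(Y_{LR(Λ)})`. -/
theorem lagrangian_relaxation {k m₁ m₂ n : ℕ}
    (A1 : Matrix (Fin m₁) (Fin n) ℝ) (b1 : Fin m₁ → ℝ)
    (A2 : Matrix (Fin m₂) (Fin n) ℝ) (b2 : Fin m₂ → ℝ)
    (C : Matrix (Fin k) (Fin n) ℝ)
    (Q : Set (Fin n → ℝ))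
    (hQ : Q = {x | (∀ j, ∃ N : ℕ, x j = (N : ℝ)) ∧ A2.mulVec x ≤ b2})
    (X : Set (Fin n → ℝ)) (hX : X = Q ∩ {x | A1.mulVec x ≤ b1})
    (Y : Set (Fin k → ℝ)) (hY : Y = (fun x => C.mulVec x) '' X)
    (Λ : Matrix (Fin k) (Fin m₁) ℝ) (hΛ : ∀ i j, 0 ≤ Λ i j)
    (YLR : Set (Fin k → ℝ))
    (hYLR : YLR = (fun x => C.mulVec x + Λ.mulVec (b1 - A1.mulVec x)) '' Q)
    (hne : (ParetoMax Y).Nonempty)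
    (hdom : ∀ y ∈ YLR, ∃ z ∈ ParetoMax YLR, y ≤ z) :
    SetPrec (ParetoMax Y) (ParetoMax YLR) := by
  subst hX hY hYLR
  refine SetPrec.of_forall_exists_le ?_
  rintro _ ⟨⟨x, ⟨hxQ, hx⟩, rfl⟩, -⟩
  obtain ⟨z, hz, hle⟩ := hdom _ ⟨x, hxQ, rfl⟩
  exact ⟨z, hz, (le_add_of_nonneg_right
    (mulVec_nonneg_of_nonneg hΛ (sub_nonneg.mpr hx))).trans hle⟩

end Stmt6
end

section
/- Assume all entries of A² and b² are rational and that Y_LDLP = {Cz : z ∈ conv(Q), A¹z ≤ b¹ componentwise} is nonempty and bounded above. Let x* be an efficient solution of the MOIP (x* ∈ X with Cx* ∈ Max(Y)) and suppose y ∈ Min(Y_LD) satisfies Cx* ≤ y. If there exists α ∈ ℝ^k with all components positive such that αᵀCz ≤ αᵀCx* for every z ∈ conv(Q) with A¹z ≤ b¹ (i.e., x* maximizes the scalarization αᵀCx over the feasible region of the MOLP max{Cx : x ∈ conv(Q), A¹x ≤ b¹}), then y = Cx*; in particular the Lagrangian dual is strong at x*. -/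
open Matrix

namespace Stmt10

/-- Nondominated (from above) points of a subset of ℝ^k. -/
def ParetoMax {k : ℕ} (S : Set (Fin k → ℝ)) : Set (Fin k → ℝ) :=
  {s ∈ S | ¬ ∃ t ∈ S, s ≤ t ∧ s ≠ t}

/-- Nondominated (from below) points of a subset of ℝ^k. -/
def ParetoMin {k : ℕ} (S : Set (Fin k → ℝ)) : Set (Fin k → ℝ) :=
  {s ∈ S | ¬ ∃ t ∈ S, t ≤ s ∧ t ≠ s}

/-- **Farkas' lemma** for finitely many linear functionals on a real vector space. -/
theorem farkas_finset {ι V : Type*} [DecidableEq ι] [AddCommGroup V] [Module ℝ V]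
    (s : Finset ι) (a : ι → V →ₗ[ℝ] ℝ) (c : V →ₗ[ℝ] ℝ)
    (h : ∀ v, (∀ i ∈ s, a i v ≤ 0) → c v ≤ 0) :
    ∃ w : ι → ℝ, (∀ i, 0 ≤ w i) ∧ ∀ v, c v = ∑ i ∈ s, w i * a i v := by
  induction s using Finset.induction_on generalizing a c with
  | empty =>
    refine ⟨0, fun _ => le_rfl, fun v => ?_⟩
    have h₁ := h v (by simp)
    have h₂ := h (-v) (by simp)
    rw [map_neg] at h₂
    simp only [Finset.sum_empty]
    linarith
  | insert j s hj ih =>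
    by_cases hc : ∀ v, (∀ i ∈ s, a i v ≤ 0) → c v ≤ 0
    · obtain ⟨w, hw, hcw⟩ := ih a c hc
      refine ⟨Function.update w j 0, fun i => ?_, fun v => ?_⟩
      · by_cases hij : i = j
        · simp [hij]
        · simpa [hij] using hw i
      · rw [Finset.sum_insert hj, hcw v]
        simp only [Function.update_self, zero_mul, zero_add]
        refine Finset.sum_congr rfl fun i hi => ?_
        rw [Function.update_of_ne (ne_of_mem_of_not_mem hi hj)]
    · push Not at hc
      obtain ⟨v₀, hv₀, hcv₀⟩ := hc
      have hpos : 0 < a j v₀ := by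
        by_contra hle
        refine absurd (h v₀ fun i hi => ?_) (not_le.mpr hcv₀)
        rcases Finset.mem_insert.mp hi with rfl | hi
        · exact not_lt.mp hle
        · exact hv₀ i hi
      set r : V →ₗ[ℝ] ℝ := (a j v₀)⁻¹ • a j with hr
      have hrv (v) : r v * a j v₀ = a j v := by
        simp only [hr, LinearMap.smul_apply, smul_eq_mul]
        field_simp
      obtain ⟨w, hw, hcw⟩ := ih (fun i => a i - a i v₀ • r) (c - c v₀ • r) (by
        intro v hv
        have := h (v - r v • v₀) (by
          intro i hi
          rcases Finset.mem_insert.mp hi with rfl | hi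
          · simp [hrv]
          · have := hv i hi
            simp only [LinearMap.sub_apply, LinearMap.smul_apply, smul_eq_mul] at this
            simp only [map_sub, map_smul, smul_eq_mul]
            linarith)
        simp only [map_sub, map_smul, smul_eq_mul] at this
        simp only [LinearMap.sub_apply, LinearMap.smul_apply, smul_eq_mul]
        linarith)
      set q : ℝ := c v₀ - ∑ i ∈ s, w i * a i v₀ with hq
      have hsum : ∑ i ∈ s, w i * a i v₀ ≤ 0 :=
        Finset.sum_nonpos fun i hi => mul_nonpos_of_nonneg_of_nonpos (hw i) (hv₀ i hi)
      refine ⟨Function.update w j (q * (a j v₀)⁻¹), fun i => ?_, fun v => ?_⟩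
      · by_cases hij : i = j
        · subst hij
          simp only [Function.update_self]
          exact mul_nonneg (by linarith) (inv_nonneg.mpr hpos.le)
        · simpa [hij] using hw i
      · have h₁ := hcw v
        simp only [LinearMap.sub_apply, LinearMap.smul_apply, smul_eq_mul, mul_sub,
          Finset.sum_sub_distrib] at h₁
        have h₂ : ∑ i ∈ s, w i * (a i v₀ * r v) = (∑ i ∈ s, w i * a i v₀) * r v := by
          rw [Finset.sum_mul]
          exact Finset.sum_congr rfl fun i _ => by ring
        have h₃ : ∑ i ∈ s, Function.update w j (q * (a j v₀)⁻¹) i * a i v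
            = ∑ i ∈ s, w i * a i v :=
          Finset.sum_congr rfl fun i hi => by
            rw [Function.update_of_ne (ne_of_mem_of_not_mem hi hj)]
        rw [Finset.sum_insert hj, h₃, Function.update_self, mul_assoc]
        have h₄ : (a j v₀)⁻¹ * a j v = r v := by simp [hr]
        rw [h₂] at h₁
        rw [h₄, hq]
        linarith

/-- Farkas' lemma for a finitely generated cone: a finite system `e j ≤ w ⬝ᵥ a j` has a
nonnegative solution `w` as soon as no nonnegative combination of the rows refutes it. -/
theorem exists_nonneg_dotProduct_ge {J : Type*} [Fintype J] {m : ℕ}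
    (a : J → Fin m → ℝ) (e : J → ℝ)
    (h : ∀ μ : J → ℝ, 0 ≤ μ → ∑ j, μ j • a j ≤ 0 → ∑ j, μ j * e j ≤ 0) :
    ∃ w : Fin m → ℝ, 0 ≤ w ∧ ∀ j, e j ≤ w ⬝ᵥ a j := by
  classical
  obtain ⟨w, hw, hew⟩ := farkas_finset (V := J → ℝ) Finset.univ
    (Sum.elim (fun i : Fin m => ∑ j, a j i • LinearMap.proj j) fun j : J => -LinearMap.proj j)
    (∑ j, e j • LinearMap.proj j) (by
      intro μ hμ
      have h₁ := h μ (fun j => by simpa using hμ (Sum.inr j) (Finset.mem_univ _))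
        (fun i => by
          have := hμ (Sum.inl i) (Finset.mem_univ _)
          simpa [LinearMap.sum_apply, Finset.sum_apply, mul_comm] using this)
      simpa [LinearMap.sum_apply, mul_comm] using h₁)
  refine ⟨fun i => w (Sum.inl i), fun i => hw _, fun j => ?_⟩
  have h₁ := hew (Pi.single j 1)
  simp only [LinearMap.sum_apply, LinearMap.smul_apply, LinearMap.proj_apply, smul_eq_mul,
    Fintype.sum_sum_type, Sum.elim_inl, Sum.elim_inr, LinearMap.neg_apply, Pi.single_apply,
    mul_ite, mul_one, mul_zero, Finset.sum_ite_eq', Finset.mem_univ, if_true, mul_neg,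
    Finset.sum_neg_distrib] at h₁
  have h₂ := hw (Sum.inr j)
  simp only [dotProduct]
  linarith

/-- Finitely many rational numbers have a common positive denominator. -/
theorem exists_common_denominator {ι : Type*} [Fintype ι] (f : ι → ℚ) :
    ∃ N : ℕ, 0 < N ∧ ∀ i, ∃ z : ℤ, (N : ℝ) * (f i : ℝ) = z := by
  classical
  refine ⟨∏ i, (f i).den, Finset.prod_pos fun i _ => (f i).den_pos, fun i => ?_⟩
  refine ⟨(∏ j ∈ Finset.univ.erase i, (f j).den : ℕ) * (f i).num, ?_⟩
  rw [← Finset.prod_erase_mul _ _ (Finset.mem_univ i)]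
  have h : ((f i).den : ℝ) * (f i : ℝ) = (f i).num := by
    exact_mod_cast Rat.den_mul_eq_num (f i)
  push_cast
  rw [mul_assoc, h]

/-- The natural vectors satisfying a rational system of linear inequalities form a semilinear
subset of `ℝ^n`. -/
theorem isSemilinearSet_natural_points {m n : ℕ} (A : Matrix (Fin m) (Fin n) ℝ) (b : Fin m → ℝ)
    (hA : ∀ i j, ∃ q : ℚ, A i j = (q : ℝ)) (hb : ∀ i, ∃ q : ℚ, b i = (q : ℝ)) :
    IsSemilinearSet {x : Fin n → ℝ | (∀ j, ∃ N : ℕ, x j = (N : ℝ)) ∧ A.mulVec x ≤ b} := by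
  choose qA hqA using hA
  choose qb hqb using hb
  choose N hN hNz using fun i : Fin m =>
    exists_common_denominator (fun o : Option (Fin n) => o.elim (qb i) (qA i))
  let cast : ((Fin n → ℕ) × (Fin m → ℕ)) →+ (Fin n → ℝ) :=
    { toFun := fun p j => (p.1 j : ℝ)
      map_zero' := by ext; simp
      map_add' := fun p q => by ext; simp }
  let f : ((Fin n → ℕ) × (Fin m → ℕ)) →+ (Fin m → ℝ) :=
    { toFun := fun p i => N i * (A.mulVec (cast p)) i + p.2 i
      map_zero' := by ext; simp
      map_add' := fun p q => by
        ext i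
        simp only [map_add, Matrix.mulVec_add, Pi.add_apply, Prod.snd_add, Nat.cast_add]
        ring }
  have hsemi := (isSemilinearSet_setOfPred_eq (0 : Fin m → ℝ) (fun i => N i * b i) f
    (0 : ((Fin n → ℕ) × (Fin m → ℕ)) →+ (Fin m → ℝ))).image cast
  convert hsemi using 1
  ext x
  constructor
  · rintro ⟨hx, hAx⟩
    choose u hu using hx
    have hslack : ∀ i, ∃ t : ℕ, (N i : ℝ) * (b i - A.mulVec x i) = t := by
      intro i
      choose z hz using hNz i
      have hint : (N i : ℝ) * (b i - A.mulVec x i)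
          = ((z none - ∑ j, z (some j) * u j : ℤ) : ℝ) := by
        push_cast
        rw [mul_sub, hqb i]
        congr 1
        · exact hz none
        · simp only [Matrix.mulVec, dotProduct, Finset.mul_sum]
          refine Finset.sum_congr rfl fun j _ => ?_
          rw [← hz (some j), hqA i j, hu j]
          simp only [Option.elim_some]
          ring
      have hnonneg : 0 ≤ (N i : ℝ) * (b i - A.mulVec x i) :=
        mul_nonneg (Nat.cast_nonneg _) (sub_nonneg.mpr (hAx i))
      rw [hint] at hnonneg ⊢
      obtain ⟨t, ht⟩ := Int.eq_ofNat_of_zero_le (Int.cast_nonneg_iff.mp hnonneg)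
      exact ⟨t, by rw [ht]; simp⟩
    choose t ht using hslack
    have hcast : cast (u, t) = x := funext fun j => (hu j).symm
    refine ⟨(u, t), ?_, hcast⟩
    ext i
    have := ht i
    simp only [Pi.add_apply, AddMonoidHom.zero_apply, Pi.zero_apply, zero_add, add_zero]
    change (N i : ℝ) * (A.mulVec (cast (u, t))) i + (t i : ℝ) = N i * b i
    rw [hcast]
    linarith
  · rintro ⟨p, hp, rfl⟩
    refine ⟨fun j => ⟨p.1 j, rfl⟩, fun i => ?_⟩
    have h₁ := congrFun hp i
    simp only [Pi.add_apply, AddMonoidHom.zero_apply, Pi.zero_apply, zero_add, add_zero] at h₁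
    change (N i : ℝ) * (A.mulVec (cast p)) i + (p.2 i : ℝ) = N i * b i at h₁
    have h₂ : (0 : ℝ) < N i := Nat.cast_pos.mpr (hN i)
    have h₃ : (0 : ℝ) ≤ p.2 i := Nat.cast_nonneg _
    exact le_of_mul_le_mul_left (by linarith) h₂

open scoped Pointwise in
/-- Seen from any of its points, the set of natural solutions of a rational system of linear
inequalities is generated by finitely many feasible displacements. -/
theorem exists_finset_displacements {m n : ℕ} (A : Matrix (Fin m) (Fin n) ℝ) (b : Fin m → ℝ)
    (hA : ∀ i j, ∃ q : ℚ, A i j = (q : ℝ)) (hb : ∀ i, ∃ q : ℚ, b i = (q : ℝ))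
    (Q : Set (Fin n → ℝ))
    (hQ : Q = {x | (∀ j, ∃ N : ℕ, x j = (N : ℝ)) ∧ A.mulVec x ≤ b})
    (x₀ : Fin n → ℝ) (hx₀ : x₀ ∈ Q) :
    ∃ D : Finset (Fin n → ℝ), (∀ d ∈ D, x₀ + d ∈ Q) ∧
      ∀ x ∈ Q, x - x₀ ∈ AddSubmonoid.closure (D : Set (Fin n → ℝ)) := by
  classical
  obtain ⟨S, hS, hlin, hQS⟩ := isSemilinearSet_natural_points A b hA hb
  rw [← hQ] at hQS
  choose! base per hper hform using hlin
  have hmem : ∀ t ∈ S, ∀ p ∈ AddSubmonoid.closure (per t), base t + p ∈ Q := by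
    intro t ht p hp
    have hpt : base t + p ∈ base t +ᵥ (AddSubmonoid.closure (per t) : Set (Fin n → ℝ)) :=
      ⟨p, hp, rfl⟩
    rw [hQS]
    exact ⟨t, ht, (Set.ext_iff.mp (hform t ht) _).mpr hpt⟩
  have hperQ : ∀ t ∈ S, ∀ p ∈ per t, x₀ + p ∈ Q := by
    intro t ht p hp
    have hmul : ∀ N : ℕ, base t + N • p ∈ Q := fun N =>
      hmem t ht _ (AddSubmonoid.nsmul_mem _ (AddSubmonoid.subset_closure hp) N)
    rw [hQ] at hmul hx₀ ⊢
    have hle : ∀ u v c : ℝ, (∀ N : ℕ, u + N * v ≤ c) → v ≤ 0 := by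
      intro u v c huv
      by_contra hv
      obtain ⟨N, hN⟩ := exists_nat_gt ((c - u) / v)
      rw [div_lt_iff₀ (not_le.mp hv)] at hN
      linarith [huv N]
    refine ⟨fun j => ?_, fun i => ?_⟩
    · obtain ⟨k₀, hk₀⟩ := (hmul 0).1 j
      obtain ⟨k₁, hk₁⟩ := (hmul 1).1 j
      obtain ⟨k₂, hk₂⟩ := hx₀.1 j
      have hpj : 0 ≤ p j := by
        have := hle (-base t j) (-p j) 0 fun N => by
          obtain ⟨k, hk⟩ := (hmul N).1 j
          have hk' : (0 : ℝ) ≤ k := Nat.cast_nonneg k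
          rw [Pi.add_apply, Pi.smul_apply, nsmul_eq_mul] at hk
          linarith
        linarith
      simp only [zero_smul, Pi.zero_apply, add_zero, one_smul, Pi.add_apply] at hk₀ hk₁
      have hk : (k₀ : ℝ) ≤ k₁ := by linarith
      refine ⟨k₂ + (k₁ - k₀), ?_⟩
      rw [Pi.add_apply, Nat.cast_add, Nat.cast_sub (Nat.cast_le.mp hk)]
      linarith
    · have hAp : A.mulVec p i ≤ 0 := hle (A.mulVec (base t) i) _ (b i) fun N => by
        have := (hmul N).2 i
        rw [← Nat.cast_smul_eq_nsmul ℝ, Matrix.mulVec_add, Matrix.mulVec_smul] at this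
        simpa using this
      have := hx₀.2 i
      rw [Matrix.mulVec_add, Pi.add_apply]
      linarith
  have hfin : ((fun t => base t - x₀) '' S ∪ ⋃ t ∈ S, per t).Finite :=
    (hS.image _).union (hS.biUnion hper)
  refine ⟨hfin.toFinset, fun d hd => ?_, fun x hx => ?_⟩
  · rw [Set.Finite.mem_toFinset] at hd
    rcases hd with ⟨t, ht, rfl⟩ | hd
    · simpa using hmem t ht 0 (zero_mem _)
    · simp only [Set.mem_iUnion] at hd
      obtain ⟨t, ht, hd⟩ := hd
      exact hperQ t ht d hd
  · rw [Set.Finite.coe_toFinset]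
    rw [hQS] at hx
    obtain ⟨t, ht, hx⟩ := hx
    rw [hform t ht] at hx
    obtain ⟨p, hp, rfl⟩ := hx
    have hsplit : (base t +ᵥ p) - x₀ = (base t - x₀) + p := by
      rw [vadd_eq_add]
      abel
    change (base t +ᵥ p) - x₀ ∈ _
    rw [hsplit]
    refine add_mem (AddSubmonoid.subset_closure (Or.inl ⟨t, ht, rfl⟩))
      (AddSubmonoid.closure_mono (fun v hv => Or.inr ?_) hp)
    exact Set.mem_biUnion ht hv

/-- Lagrange multipliers for maximizing a linear functional over the convex hull of a set that is
finitely generated as seen from the maximizer `x₀`, under additional linear constraints. -/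
theorem exists_multipliers {m n : ℕ} (A : Matrix (Fin m) (Fin n) ℝ) (b : Fin m → ℝ)
    (c : Fin n → ℝ) (Q : Set (Fin n → ℝ)) (x₀ : Fin n → ℝ) (hx₀ : x₀ ∈ Q)
    (hfeas : A.mulVec x₀ ≤ b)
    (D : Finset (Fin n → ℝ)) (hD : ∀ d ∈ D, x₀ + d ∈ Q)
    (hgen : ∀ x ∈ Q, x - x₀ ∈ AddSubmonoid.closure (D : Set (Fin n → ℝ)))
    (hmax : ∀ z ∈ convexHull ℝ Q, A.mulVec z ≤ b → c ⬝ᵥ z ≤ c ⬝ᵥ x₀) :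
    ∃ w : Fin m → ℝ, 0 ≤ w ∧ w ⬝ᵥ (b - A.mulVec x₀) = 0 ∧
      ∀ x ∈ Q, c ⬝ᵥ x + w ⬝ᵥ (b - A.mulVec x) ≤ c ⬝ᵥ x₀ := by
  obtain ⟨w, hw, hwD⟩ := exists_nonneg_dotProduct_ge (J := Option D)
    (fun o => o.elim (A.mulVec x₀ - b) fun d => A.mulVec d)
    (fun o => o.elim 0 fun d => c ⬝ᵥ (d : Fin n → ℝ)) (by
      intro μ hμ hle
      simp only [Fintype.sum_option, Option.elim_none, Option.elim_some, mul_zero,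
        zero_add] at hle ⊢
      set v : Fin n → ℝ := ∑ d : D, μ (some d) • (d : Fin n → ℝ) with hv
      have hAv : ∑ d : D, μ (some d) • A.mulVec (d : Fin n → ℝ) = A.mulVec v := by
        rw [hv, Matrix.mulVec_sum]
        simp only [Matrix.mulVec_smul]
      have hcv : ∑ d : D, μ (some d) * c ⬝ᵥ (d : Fin n → ℝ) = c ⬝ᵥ v := by
        rw [hv, dotProduct_sum]
        simp only [dotProduct_smul, smul_eq_mul]
      rw [hAv] at hle
      rw [hcv]
      set σ : ℝ := ∑ d : D, μ (some d) with hσ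
      have hσ₀ : 0 ≤ σ := Finset.sum_nonneg fun d _ => hμ _
      have hμ₀ : 0 ≤ μ none := hμ none
      set s : ℝ := σ + μ none + 1 with hs
      have hs₀ : 0 < s := by linarith
      have hz : x₀ + s⁻¹ • v ∈ convexHull ℝ Q := by
        have hconv := (convex_convexHull ℝ Q).sum_mem (t := Finset.univ)
          (w := fun o : Option D => o.elim (1 - s⁻¹ * σ) fun d => s⁻¹ * μ (some d))
          (z := fun o : Option D => o.elim x₀ fun d => x₀ + d) (by
            rintro (_ | d) -
            · have : s⁻¹ * σ ≤ 1 := by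
                rw [inv_mul_le_iff₀ hs₀]
                linarith
              simpa using this
            · exact mul_nonneg (inv_nonneg.mpr hs₀.le) (hμ _))
          (by
            simp only [Fintype.sum_option, Option.elim_none, Option.elim_some,
              ← Finset.mul_sum, ← hσ]
            ring)
          (by
            rintro (_ | d) -
            · exact subset_convexHull ℝ Q hx₀
            · exact subset_convexHull ℝ Q (hD d d.2))
        convert hconv using 1
        simp only [Fintype.sum_option, Option.elim_none, Option.elim_some, smul_add,
          Finset.sum_add_distrib, ← Finset.sum_smul, mul_smul,
          ← Finset.smul_sum, ← hσ, ← hv, sub_smul, one_smul]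
        abel
      have hfz : A.mulVec (x₀ + s⁻¹ • v) ≤ b := by
        intro i
        have h₁ := hle i
        have h₂ := hfeas i
        simp only [Pi.add_apply, Pi.smul_apply, Pi.sub_apply, smul_eq_mul, Pi.zero_apply] at h₁
        rw [Matrix.mulVec_add, Matrix.mulVec_smul]
        simp only [Pi.add_apply, Pi.smul_apply, smul_eq_mul]
        have h₃ : s⁻¹ * A.mulVec v i ≤ b i - A.mulVec x₀ i := by
          rw [inv_mul_le_iff₀ hs₀]
          nlinarith
        linarith
      have h₁ := hmax _ hz hfz
      rw [dotProduct_add, dotProduct_smul, smul_eq_mul] at h₁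
      have h₂ : s⁻¹ * c ⬝ᵥ v ≤ 0 := by linarith
      by_contra hpos
      exact absurd h₂ (not_le.mpr (mul_pos (inv_pos.mpr hs₀) (not_le.mp hpos))))
  have hslack : w ⬝ᵥ (b - A.mulVec x₀) = 0 := by
    have h₁ := hwD none
    simp only [Option.elim_none] at h₁
    have h₂ : 0 ≤ w ⬝ᵥ (b - A.mulVec x₀) :=
      dotProduct_nonneg_of_nonneg hw (sub_nonneg.mpr hfeas)
    rw [← neg_sub, dotProduct_neg] at h₁
    linarith
  have hclosure : ∀ d ∈ AddSubmonoid.closure (D : Set (Fin n → ℝ)),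
      c ⬝ᵥ d ≤ w ⬝ᵥ A.mulVec d := by
    intro d hd
    induction hd using AddSubmonoid.closure_induction with
    | mem d hd => exact hwD (some ⟨d, hd⟩)
    | zero => simp
    | add u v _ _ hu hv =>
      rw [Matrix.mulVec_add, dotProduct_add, dotProduct_add]
      linarith
  refine ⟨w, hw, hslack, fun x hx => ?_⟩
  have h₁ := hclosure _ (hgen x hx)
  rw [Matrix.mulVec_sub, dotProduct_sub, dotProduct_sub] at h₁
  rw [dotProduct_sub] at hslack ⊢
  linarith

/-- A point of a set that maximizes a positive scalarization is nondominated. -/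
theorem mem_paretoMax_of_scalarization {k : ℕ} {S : Set (Fin k → ℝ)} {s α : Fin k → ℝ}
    (hs : s ∈ S) (hα : ∀ i, 0 < α i) (hmax : ∀ t ∈ S, α ⬝ᵥ t ≤ α ⬝ᵥ s) : s ∈ ParetoMax S := by
  refine ⟨hs, ?_⟩
  rintro ⟨t, ht, hle, hne⟩
  obtain ⟨i, hi⟩ := (Pi.lt_def.mp (lt_of_le_of_ne hle hne)).2
  refine absurd (hmax t ht) (not_le.mpr ?_)
  exact Finset.sum_lt_sum (fun j _ => mul_le_mul_of_nonneg_left (hle j) (hα j).le)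
    ⟨i, Finset.mem_univ i, mul_lt_mul_of_pos_left hi (hα i)⟩

/-- A sufficient condition for strong Lagrangian duality at an efficient solution `x*`:
if `x*` maximizes a positive scalarization over the feasible region of the MOLP
`max {Cx : x ∈ conv(Q), A¹x ≤ b¹}`, then any `y ∈ Min(Y_LD)` with `Cx* ≤ y`
satisfies `y = Cx*`. -/
theorem strong_duality_sufficient {k m₁ m₂ n : ℕ}
    (A1 : Matrix (Fin m₁) (Fin n) ℝ) (b1 : Fin m₁ → ℝ)
    (A2 : Matrix (Fin m₂) (Fin n) ℝ) (b2 : Fin m₂ → ℝ)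
    (C : Matrix (Fin k) (Fin n) ℝ)
    (hA2rat : ∀ i j, ∃ q : ℚ, A2 i j = (q : ℝ)) (hb2rat : ∀ i, ∃ q : ℚ, b2 i = (q : ℝ))
    (Q : Set (Fin n → ℝ))
    (hQ : Q = {x | (∀ j, ∃ N : ℕ, x j = (N : ℝ)) ∧ A2.mulVec x ≤ b2})
    (X : Set (Fin n → ℝ)) (hX : X = Q ∩ {x | A1.mulVec x ≤ b1})
    (Y : Set (Fin k → ℝ)) (hY : Y = (fun x => C.mulVec x) '' X)
    (YLD : Set (Fin k → ℝ))
    (hYLD : YLD = ⋃ Λ ∈ {Λ : Matrix (Fin k) (Fin m₁) ℝ | ∀ i j, 0 ≤ Λ i j},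
      ParetoMax ((fun x => C.mulVec x + Λ.mulVec (b1 - A1.mulVec x)) '' Q))
    (YLDLP : Set (Fin k → ℝ))
    (hYLDLP : YLDLP =
      (fun x => C.mulVec x) '' {x | x ∈ convexHull ℝ Q ∧ A1.mulVec x ≤ b1})
    (hLDLPne : YLDLP.Nonempty)
    (hLDLPbdd : ∃ z : Fin k → ℝ, ∀ y ∈ YLDLP, y ≤ z)
    (xstar : Fin n → ℝ) (hxX : xstar ∈ X) (heff : C.mulVec xstar ∈ ParetoMax Y)
    (y : Fin k → ℝ) (hy : y ∈ ParetoMin YLD) (hle : C.mulVec xstar ≤ y)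
    (α : Fin k → ℝ) (hα : ∀ i, 0 < α i)
    (hscal : ∀ z ∈ convexHull ℝ Q, A1.mulVec z ≤ b1 →
      α ⬝ᵥ C.mulVec z ≤ α ⬝ᵥ C.mulVec xstar) :
    y = C.mulVec xstar := by
  rcases Nat.eq_zero_or_pos k with rfl | hk
  · exact Subsingleton.elim _ _
  rw [hX] at hxX
  obtain ⟨hxQ, hxfeas⟩ := hxX
  obtain ⟨D, hD, hgen⟩ := exists_finset_displacements A2 b2 hA2rat hb2rat Q hQ xstar hxQ
  obtain ⟨w, hw, hslack, hbound⟩ := exists_multipliers A1 b1 (α ᵥ* C) Q xstar hxQ hxfeas D hD hgen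
    (by simpa only [dotProduct_mulVec] using hscal)
  have hαsum : 0 < ∑ i, α i :=
    Finset.sum_pos (fun i _ => hα i) ⟨⟨0, hk⟩, Finset.mem_univ _⟩
  set Λ : Matrix (Fin k) (Fin m₁) ℝ := fun _ j => (∑ i, α i)⁻¹ * w j with hΛ
  have hΛmul : ∀ u : Fin m₁ → ℝ, Λ.mulVec u = fun _ => (∑ i, α i)⁻¹ * w ⬝ᵥ u := by
    intro u
    ext i
    simp only [hΛ, Matrix.mulVec, dotProduct, Finset.mul_sum, mul_assoc]
  have hαΛ : ∀ u : Fin m₁ → ℝ, α ⬝ᵥ Λ.mulVec u = w ⬝ᵥ u := by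
    intro u
    rw [hΛmul]
    simp only [dotProduct, ← Finset.sum_mul]
    field_simp
  have hmem : C.mulVec xstar ∈ YLD := by
    rw [hYLD]
    refine Set.mem_biUnion (x := Λ)
      (fun i j => mul_nonneg (inv_nonneg.mpr hαsum.le) (hw j)) ?_
    refine mem_paretoMax_of_scalarization ⟨xstar, hxQ, ?_⟩ hα ?_
    · ext i
      simp [hΛmul, hslack]
    · rintro _ ⟨x, hx, rfl⟩
      simp only [dotProduct_add, hαΛ, dotProduct_mulVec]
      simpa only [dotProduct_mulVec] using hbound x hx
  by_contra hne
  exact hy.2 ⟨_, hmem, hle, Ne.symm hne⟩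

end Stmt10
end

section
/- Assume Q is nonempty and finite, and that conv(Q ∩ {x ∈ ℝ^n : A¹x ≤ b¹}) = conv(Q) ∩ {x ∈ ℝ^n : A¹x ≤ b¹}. Let μ ∈ ℝ^k have all components positive and let x* ∈ X = Q ∩ {x : A¹x ≤ b¹} satisfy μᵀCx ≤ μᵀCx* for all x ∈ X (x* is a supported solution with scalarizing vector μ). If ỹ ∈ Min(Y_LD) is comparable with Cx* (that is, ỹ ≤ Cx* or Cx* ≤ ỹ), then ỹ = Cx*; in particular the Lagrangian dual is strong at x*. -/
open Matrix

namespace Stmt13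

/-- Nondominated (from above) points of a subset of ℝ^k. -/
def ParetoMax {k : ℕ} (S : Set (Fin k → ℝ)) : Set (Fin k → ℝ) :=
  {s ∈ S | ¬ ∃ t ∈ S, s ≤ t ∧ s ≠ t}

/-- Nondominated (from below) points of a subset of ℝ^k. -/
def ParetoMin {k : ℕ} (S : Set (Fin k → ℝ)) : Set (Fin k → ℝ) :=
  {s ∈ S | ¬ ∃ t ∈ S, t ≤ s ∧ t ≠ s}

/-- **Farkas' lemma**: a linear functional that is nonpositive wherever finitely many linear
functionals are nonpositive is a nonnegative combination of them. -/
theorem exists_nonneg_sum_smul_eq_of_nonpos {ι V : Type*} [AddCommGroup V] [Module ℝ V]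
    (s : Finset ι) (a : ι → V →ₗ[ℝ] ℝ) (f : V →ₗ[ℝ] ℝ)
    (h : ∀ x, (∀ i ∈ s, a i x ≤ 0) → f x ≤ 0) :
    ∃ c : ι → ℝ, (∀ i, 0 ≤ c i) ∧ f = ∑ i ∈ s, c i • a i := by
  classical
  have hupd : ∀ {s : Finset ι} {j : ι}, j ∉ s → ∀ (a : ι → V →ₗ[ℝ] ℝ) (c : ι → ℝ) (r : ℝ),
      ∑ i ∈ s, Function.update c j r i • a i = ∑ i ∈ s, c i • a i := fun hj a c r =>
    Finset.sum_congr rfl fun i hi => by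
      rw [Function.update_of_ne (ne_of_mem_of_not_mem hi hj)]
  induction s using Finset.induction_on generalizing a f with
  | empty =>
    refine ⟨0, fun _ => le_rfl, LinearMap.ext fun x => ?_⟩
    have h₁ := h x (by simp)
    have h₂ := h (-x) (by simp)
    rw [map_neg] at h₂
    simp only [Finset.sum_empty, LinearMap.zero_apply]
    linarith
  | insert j s hj ih =>
    by_cases hs : ∀ x, (∀ i ∈ s, a i x ≤ 0) → f x ≤ 0
    · obtain ⟨c, hc, rfl⟩ := ih a f hs
      refine ⟨Function.update c j 0, fun i => ?_, ?_⟩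
      · by_cases hi : i = j
        · simp [hi]
        · simpa [hi] using hc i
      · rw [Finset.sum_insert hj, Function.update_self, zero_smul, zero_add, hupd hj]
    · push Not at hs
      obtain ⟨x₀, hx₀, hf⟩ := hs
      have hpos : 0 < a j x₀ := by
        by_contra! hle
        exact hf.not_ge (h x₀ fun i hi => by
          rcases Finset.mem_insert.1 hi with rfl | hi
          exacts [hle, hx₀ i hi])
      obtain ⟨c, hc, hfc⟩ := ih (fun i => a i - (a i x₀ / a j x₀) • a j)
        (f - (f x₀ / a j x₀) • a j) fun x hx => by
          have key := h (x - (a j x / a j x₀) • x₀) fun i hi => by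
            rcases Finset.mem_insert.1 hi with rfl | hi
            · simp [hpos.ne']
            · have := hx i hi
              simp only [LinearMap.sub_apply, LinearMap.smul_apply, smul_eq_mul, map_sub,
                map_smul] at this ⊢
              convert this using 2
              ring
          simp only [LinearMap.sub_apply, LinearMap.smul_apply, smul_eq_mul, map_sub,
            map_smul] at key ⊢
          convert key using 2
          ring
      refine ⟨Function.update c j ((f x₀ - ∑ i ∈ s, c i * a i x₀) / a j x₀), fun i => ?_, ?_⟩
      · by_cases hi : i = j
        · subst hi
          rw [Function.update_self]
          refine div_nonneg (sub_nonneg.2 (le_trans ?_ hf.le)) hpos.le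
          exact Finset.sum_nonpos fun l hl => mul_nonpos_of_nonneg_of_nonpos (hc l) (hx₀ l hl)
        · simpa [hi] using hc i
      · rw [Finset.sum_insert hj, Function.update_self, hupd hj]
        refine LinearMap.ext fun x => ?_
        have hx := LinearMap.congr_fun hfc x
        simp only [LinearMap.sub_apply, LinearMap.smul_apply, LinearMap.add_apply,
          LinearMap.sum_apply, smul_eq_mul, mul_sub, Finset.sum_sub_distrib] at hx ⊢
        have hsum : ∑ i ∈ s, c i * (a i x₀ / a j x₀ * a j x)
            = (∑ i ∈ s, c i * a i x₀) / a j x₀ * a j x := by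
          rw [Finset.sum_div, Finset.sum_mul]
          exact Finset.sum_congr rfl fun i _ => by ring
        rw [hsum] at hx
        rw [sub_div, sub_mul]
        linarith

/-- **Lagrange multipliers for a polytope**: an upper bound for a linear functional on the part
of the convex hull of a finite set cut out by `A x ≤ b` is certified by a nonnegative `l`. -/
theorem exists_lagrange_multiplier {m n : ℕ} (A : Matrix (Fin m) (Fin n) ℝ) (b : Fin m → ℝ)
    {Q : Set (Fin n → ℝ)} (hQ : Q.Finite) (c : Fin n → ℝ) (v : ℝ)
    (h : ∀ x ∈ convexHull ℝ Q, A *ᵥ x ≤ b → c ⬝ᵥ x ≤ v) :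
    ∃ l : Fin m → ℝ, 0 ≤ l ∧ ∀ x ∈ Q, c ⬝ᵥ x + l ⬝ᵥ (b - A *ᵥ x) ≤ v := by
  classical
  have := hQ.fintype
  let a : Q ⊕ Fin m → (Q → ℝ) →ₗ[ℝ] ℝ := Sum.elim
    (fun q => -LinearMap.proj q)
    (fun j => -∑ q : Q, (b - A *ᵥ q.1) j • LinearMap.proj q)
  let f : (Q → ℝ) →ₗ[ℝ] ℝ := ∑ q : Q, (c ⬝ᵥ q.1 - v) • LinearMap.proj q
  obtain ⟨d, hd, hfd⟩ := exists_nonneg_sum_smul_eq_of_nonpos Finset.univ a f fun w hw => by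
    have hw0 : ∀ q, 0 ≤ w q := fun q => by simpa [a] using hw (.inl q) (Finset.mem_univ _)
    have hA : ∀ j, 0 ≤ ∑ q : Q, (b - A *ᵥ q.1) j * w q := fun j => by
      simpa only [a, Sum.elim_inr, LinearMap.neg_apply, LinearMap.sum_apply,
        LinearMap.smul_apply, LinearMap.proj_apply, smul_eq_mul, neg_nonpos] using
        hw (.inr j) (Finset.mem_univ _)
    simp only [f, LinearMap.sum_apply, LinearMap.smul_apply, LinearMap.proj_apply, smul_eq_mul]
    rcases (Finset.sum_nonneg fun q _ => hw0 q).eq_or_lt with hW | hW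
    · have hz := (Finset.sum_eq_zero_iff_of_nonneg fun q _ => hw0 q).1 hW.symm
      exact (Finset.sum_eq_zero fun q hq => by rw [hz q hq, mul_zero]).le
    · have hmem := Finset.univ.centerMass_mem_convexHull (R := ℝ) (w := w) (z := Subtype.val)
        (s := Q) (fun q _ => hw0 q) hW fun q _ => q.2
      have hle := h _ hmem fun j => by
        have hj := hA j
        simp only [Pi.sub_apply, sub_mul, Finset.sum_sub_distrib, ← Finset.mul_sum] at hj
        rw [Finset.centerMass, mulVec_smul, mulVec_sum, Pi.smul_apply, Finset.sum_apply,
          smul_eq_mul, inv_mul_le_iff₀ hW]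
        simp only [mulVec_smul, Pi.smul_apply, smul_eq_mul, mul_comm (w _)]
        linarith
      rw [Finset.centerMass, dotProduct_smul, dotProduct_sum, smul_eq_mul,
        inv_mul_le_iff₀ hW] at hle
      simp only [dotProduct_smul, smul_eq_mul, mul_comm (w _)] at hle
      simp only [sub_mul, Finset.sum_sub_distrib, ← Finset.mul_sum]
      linarith
  refine ⟨fun j => d (.inr j), fun j => hd _, fun x hx => ?_⟩
  have hval := LinearMap.congr_fun hfd (Pi.single ⟨x, hx⟩ 1)
  simp only [f, a, LinearMap.sum_apply, LinearMap.add_apply, LinearMap.smul_apply,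
    LinearMap.neg_apply, LinearMap.proj_apply, smul_eq_mul, Fintype.sum_sum_type, Sum.elim_inl, Sum.elim_inr,
    Pi.single_apply, mul_ite, mul_one, mul_zero, Finset.sum_ite_eq', Finset.mem_univ, if_true,
    mul_neg, Finset.sum_neg_distrib] at hval
  have hx0 := hd (.inl ⟨x, hx⟩)
  simp only [dotProduct] at hval ⊢
  linarith

/-- A scalarizing vector with positive components detects strict dominance. -/
theorem dotProduct_lt_dotProduct_of_pos {k : ℕ} {μ s t : Fin k → ℝ} (hμ : ∀ i, 0 < μ i)
    (hst : s ≤ t) (hne : s ≠ t) : μ ⬝ᵥ s < μ ⬝ᵥ t := by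
  obtain ⟨i, hi⟩ := Function.ne_iff.1 hne
  exact Finset.sum_lt_sum (fun j _ => mul_le_mul_of_nonneg_left (hst j) (hμ j).le)
    ⟨i, Finset.mem_univ i, mul_lt_mul_of_pos_left (lt_of_le_of_ne (hst i) hi) (hμ i)⟩

/-- Under the convex hull intersection condition, the Lagrangian dual is strong at a
supported solution `x*`: any `ỹ ∈ Min(Y_LD)` comparable with `Cx*` equals `Cx*`. -/
theorem lagrangian_dual_strong_at_supported {k m₁ m₂ n : ℕ}
    (A1 : Matrix (Fin m₁) (Fin n) ℝ) (b1 : Fin m₁ → ℝ)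
    (A2 : Matrix (Fin m₂) (Fin n) ℝ) (b2 : Fin m₂ → ℝ)
    (C : Matrix (Fin k) (Fin n) ℝ)
    (Q : Set (Fin n → ℝ))
    (hQ : Q = {x | (∀ j, ∃ N : ℕ, x j = (N : ℝ)) ∧ A2.mulVec x ≤ b2})
    (hQne : Q.Nonempty) (hQfin : Q.Finite)
    (hconv : convexHull ℝ (Q ∩ {x | A1.mulVec x ≤ b1})
      = convexHull ℝ Q ∩ {x | A1.mulVec x ≤ b1})
    (X : Set (Fin n → ℝ)) (hX : X = Q ∩ {x | A1.mulVec x ≤ b1})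
    (YLD : Set (Fin k → ℝ))
    (hYLD : YLD = ⋃ Λ ∈ {Λ : Matrix (Fin k) (Fin m₁) ℝ | ∀ i j, 0 ≤ Λ i j},
      ParetoMax ((fun x => C.mulVec x + Λ.mulVec (b1 - A1.mulVec x)) '' Q))
    (μ : Fin k → ℝ) (hμ : ∀ i, 0 < μ i)
    (xstar : Fin n → ℝ) (hxX : xstar ∈ X)
    (hsupp : ∀ x ∈ X, μ ⬝ᵥ C.mulVec x ≤ μ ⬝ᵥ C.mulVec xstar)
    (ytil : Fin k → ℝ) (hytil : ytil ∈ ParetoMin YLD)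
    (hcomp : ytil ≤ C.mulVec xstar ∨ C.mulVec xstar ≤ ytil) :
    ytil = C.mulVec xstar := by
  subst hX hYLD
  obtain ⟨hy, hmin⟩ := hytil
  by_contra hne
  rcases hcomp with hle | hge
  · simp only [Set.mem_iUnion] at hy
    obtain ⟨Λ, hΛ, -, hmax⟩ := hy
    have hrelax : C *ᵥ xstar ≤ C *ᵥ xstar + Λ *ᵥ (b1 - A1 *ᵥ xstar) :=
      le_add_of_nonneg_right fun i =>
        dotProduct_nonneg_of_nonneg (hΛ i) (sub_nonneg.2 hxX.2)
    exact hmax ⟨_, ⟨xstar, hxX.1, rfl⟩, hle.trans hrelax,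
      fun h => hne (le_antisymm hle (h ▸ hrelax))⟩
  refine hmin ⟨C *ᵥ xstar, ?_, hge, Ne.symm hne⟩
  have hbound : ∀ x ∈ convexHull ℝ Q, A1 *ᵥ x ≤ b1 → (μ ᵥ* C) ⬝ᵥ x ≤ μ ⬝ᵥ C *ᵥ xstar := by
    intro x hx hAx
    have hx' : x ∈ convexHull ℝ (Q ∩ {x | A1 *ᵥ x ≤ b1}) := hconv ▸ ⟨hx, hAx⟩
    refine convexHull_min (fun z hz => ?_)
      (convex_halfSpace_le (f := fun z => (μ ᵥ* C) ⬝ᵥ z)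
        ⟨fun _ _ => dotProduct_add _ _ _, fun _ _ => dotProduct_smul _ _ _⟩ _) hx'
    simpa only [Set.mem_ofPred_eq, ← dotProduct_mulVec] using hsupp z hz
  obtain ⟨l, hl, hlQ⟩ := exists_lagrange_multiplier A1 b1 hQfin (μ ᵥ* C) _ hbound
  obtain ⟨i₀, -⟩ := Function.ne_iff.1 hne
  have hsum : 0 < ∑ i, μ i := Finset.sum_pos (fun i _ => hμ i) ⟨i₀, Finset.mem_univ i₀⟩
  have hslack : l ⬝ᵥ (b1 - A1 *ᵥ xstar) = 0 := by
    refine le_antisymm ?_ (dotProduct_nonneg_of_nonneg hl (sub_nonneg.2 hxX.2))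
    have := hlQ xstar hxX.1
    rw [← dotProduct_mulVec] at this
    linarith
  let Λ : Matrix (Fin k) (Fin m₁) ℝ := of fun _ j => (∑ i, μ i)⁻¹ * l j
  have hΛ : ∀ u, Λ *ᵥ u = fun _ => (∑ i, μ i)⁻¹ * (l ⬝ᵥ u) := fun u => by
    ext i
    simp [Λ, mulVec, dotProduct, Finset.mul_sum, mul_assoc]
  have hstar : C *ᵥ xstar + Λ *ᵥ (b1 - A1 *ᵥ xstar) = C *ᵥ xstar := by
    ext i
    simp [hΛ, hslack]
  simp only [Set.mem_iUnion]
  refine ⟨Λ, fun i j => mul_nonneg (inv_nonneg.2 hsum.le) (hl j), ⟨xstar, hxX.1, hstar⟩, ?_⟩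
  rintro ⟨_, ⟨x, hx, rfl⟩, hle, hne'⟩
  have hlt := dotProduct_lt_dotProduct_of_pos hμ hle hne'
  have hscal : μ ⬝ᵥ Λ *ᵥ (b1 - A1 *ᵥ x) = l ⬝ᵥ (b1 - A1 *ᵥ x) := by
    rw [hΛ, dotProduct, ← Finset.sum_mul, mul_inv_cancel_left₀ hsum.ne']
  rw [dotProduct_add, hscal, dotProduct_mulVec μ C x] at hlt
  exact hlt.not_ge (hlQ x hx)

end Stmt13
end

section
/- Let x ∈ X be an unsupported efficient solution of the MOIP: Cx ∈ Max(Y) and for every μ ∈ ℝ^k with all components positive there exists ξ ∈ X with μᵀCx < μᵀCξ. Suppose there exist Λ* ∈ ℝ^{k×m₁} with nonnegative entries and x* ∈ Q such that, writing w* = Cx* + Λ*(b¹ − A¹x*): (i) Cx ⪇ w*; and (ii) for every Λ ∈ ℝ^{k×m₁} with nonnegative entries, every v ∈ Max(Y_{LR(Λ)}) with v ≤ w* is a supported objective value of LR(Λ), meaning there exists μ_v ∈ ℝ^k with all components positive such that μ_vᵀ(Cξ + Λ(b¹ − A¹ξ)) ≤ μ_vᵀv for all ξ ∈ Q. Then Cx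 ∉ Y_LD; in particular there is no y ∈ Min(Y_LD) with y = Cx, so the Lagrangian dual is not strong at x. -/
open Matrix

namespace Stmt14

/-- Nondominated (from above) points of a subset of ℝ^k. -/
def ParetoMax {k : ℕ} (S : Set (Fin k → ℝ)) : Set (Fin k → ℝ) :=
  {s ∈ S | ¬ ∃ t ∈ S, s ≤ t ∧ s ≠ t}

/-- A sufficient condition under which the Lagrangian dual is not strong at an
unsupported efficient solution `x`: its objective value `Cx` does not belong to `Y_LD`. -/
theorem not_strong_at_unsupported {k m₁ m₂ n : ℕ}
    (A1 : Matrix (Fin m₁) (Fin n) ℝ) (b1 : Fin m₁ → ℝ)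
    (A2 : Matrix (Fin m₂) (Fin n) ℝ) (b2 : Fin m₂ → ℝ)
    (C : Matrix (Fin k) (Fin n) ℝ)
    (Q : Set (Fin n → ℝ))
    (hQ : Q = {x | (∀ j, ∃ N : ℕ, x j = (N : ℝ)) ∧ A2.mulVec x ≤ b2})
    (X : Set (Fin n → ℝ)) (hX : X = Q ∩ {x | A1.mulVec x ≤ b1})
    (Y : Set (Fin k → ℝ)) (hY : Y = (fun x => C.mulVec x) '' X)
    (YLD : Set (Fin k → ℝ))
    (hYLD : YLD = ⋃ Λ ∈ {Λ : Matrix (Fin k) (Fin m₁) ℝ | ∀ i j, 0 ≤ Λ i j},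
      ParetoMax ((fun x => C.mulVec x + Λ.mulVec (b1 - A1.mulVec x)) '' Q))
    (x : Fin n → ℝ) (hxX : x ∈ X) (heff : C.mulVec x ∈ ParetoMax Y)
    (hunsupp : ∀ μ : Fin k → ℝ, (∀ i, 0 < μ i) →
      ∃ ξ ∈ X, μ ⬝ᵥ C.mulVec x < μ ⬝ᵥ C.mulVec ξ)
    (Λstar : Matrix (Fin k) (Fin m₁) ℝ) (hΛstar : ∀ i j, 0 ≤ Λstar i j)
    (xstar : Fin n → ℝ) (hxstarQ : xstar ∈ Q)
    (hdom : C.mulVec x ≤ C.mulVec xstar + Λstar.mulVec (b1 - A1.mulVec xstar) ∧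
      C.mulVec x ≠ C.mulVec xstar + Λstar.mulVec (b1 - A1.mulVec xstar))
    (hsupported : ∀ Λ : Matrix (Fin k) (Fin m₁) ℝ, (∀ i j, 0 ≤ Λ i j) →
      ∀ v ∈ ParetoMax ((fun ξ => C.mulVec ξ + Λ.mulVec (b1 - A1.mulVec ξ)) '' Q),
        v ≤ C.mulVec xstar + Λstar.mulVec (b1 - A1.mulVec xstar) →
        ∃ μv : Fin k → ℝ, (∀ i, 0 < μv i) ∧
          ∀ ξ ∈ Q, μv ⬝ᵥ (C.mulVec ξ + Λ.mulVec (b1 - A1.mulVec ξ)) ≤ μv ⬝ᵥ v) :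
    C.mulVec x ∉ YLD := by
  intro hx
  rw [hYLD] at hx
  simp only [Set.mem_iUnion, Set.mem_ofPred_eq] at hx
  obtain ⟨Λ, hΛ, hx⟩ := hx
  obtain ⟨μ, hμ, hmax⟩ := hsupported Λ hΛ _ hx hdom.1
  obtain ⟨ξ, hξ, hlt⟩ := hunsupp μ hμ
  rw [hX] at hξ
  have hslack : 0 ≤ Λ.mulVec (b1 - A1.mulVec ξ) := fun i =>
    dotProduct_nonneg_of_nonneg (fun j => hΛ i j) (sub_nonneg.2 hξ.2)
  have hge : 0 ≤ μ ⬝ᵥ Λ.mulVec (b1 - A1.mulVec ξ) :=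
    dotProduct_nonneg_of_nonneg (fun i => (hμ i).le) hslack
  have hle := hmax ξ hξ.1
  rw [dotProduct_add] at hle
  linarith

end Stmt14
end

section
/- Let β₁, β₂ ∈ ℝ^m. Assume Y(β₁) and Y(β₂) are nonempty, and that for each β ∈ {β₁, β₂, β₁ + β₂} every element of Y(β) is dominated by some element of Z(β), i.e., for each y ∈ Y(β) there is z ∈ Z(β) with y ≤ z (this holds, e.g., when each X(β) is finite and nonempty). Then the MOIP value function Z is nondecreasing and superadditive with respect to ⪯: (a) if β₁ ≤ β₂ componentwise, then Z(β₁) ⪯ Z(β₂); and (b) Z(β₁) + Z(β₂) ⪯ Z(β₁ + β₂), where + denotes the Minkowski sum of sets. -/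
open Pointwise

namespace Stmt15

/-- Nondominated (from above) points of a subset of ℝ^k. -/
def ParetoMax {k : ℕ} (S : Set (Fin k → ℝ)) : Set (Fin k → ℝ) :=
  {s ∈ S | ¬ ∃ t ∈ S, s ≤ t ∧ s ≠ t}

/-- The Pareto set-ordering `S ⪯ T`. -/
def SetPrec {k : ℕ} (S T : Set (Fin k → ℝ)) : Prop :=
  (∀ s ∈ S, ∃ t ∈ T, s ≤ t) ∧ ∀ s ∈ S, ∀ t ∈ T, ¬(t ≤ s ∧ t ≠ s)

/-- A subset of `Y` precedes `ParetoMax Y` as soon as `ParetoMax Y` dominates `Y`. -/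
theorem setPrec_paretoMax_of_subset {k : ℕ} {S Y : Set (Fin k → ℝ)} (hS : S ⊆ Y)
    (hY : ∀ y ∈ Y, ∃ z ∈ ParetoMax Y, y ≤ z) : SetPrec S (ParetoMax Y) :=
  ⟨fun s hs => hY s (hS hs), fun s hs _ ht h => ht.2 ⟨s, hS hs, h⟩⟩

theorem paretoMax_subset {k : ℕ} (S : Set (Fin k → ℝ)) : ParetoMax S ⊆ S :=
  fun _ hs => hs.1

/-- The MOIP value function `Z(β) = Max({Cx : x ∈ X(β)})` is nondecreasing and
superadditive with respect to the Pareto set-ordering. -/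
theorem value_function_nondecreasing_superadditive {k m n : ℕ}
    (A : Matrix (Fin m) (Fin n) ℝ) (C : Matrix (Fin k) (Fin n) ℝ)
    (Xf : (Fin m → ℝ) → Set (Fin n → ℝ))
    (hXf : Xf = fun β => {x | (∀ j, ∃ N : ℕ, x j = (N : ℝ)) ∧ A.mulVec x ≤ β})
    (Yf : (Fin m → ℝ) → Set (Fin k → ℝ))
    (hYf : Yf = fun β => (fun x => C.mulVec x) '' Xf β)
    (Zf : (Fin m → ℝ) → Set (Fin k → ℝ))
    (hZf : Zf = fun β => ParetoMax (Yf β))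
    (β₁ β₂ : Fin m → ℝ)
    (hne1 : (Yf β₁).Nonempty) (hne2 : (Yf β₂).Nonempty)
    (hdom : ∀ β ∈ ({β₁, β₂, β₁ + β₂} : Set (Fin m → ℝ)),
      ∀ y ∈ Yf β, ∃ z ∈ Zf β, y ≤ z) :
    (β₁ ≤ β₂ → SetPrec (Zf β₁) (Zf β₂)) ∧
      SetPrec (Zf β₁ + Zf β₂) (Zf (β₁ + β₂)) := by
  subst hZf hYf hXf
  refine ⟨fun hle => setPrec_paretoMax_of_subset ?_ (hdom β₂ (by simp)),
    setPrec_paretoMax_of_subset ?_ (hdom (β₁ + β₂) (by simp))⟩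
  · rintro _ hy
    obtain ⟨x, ⟨hint, hx⟩, rfl⟩ := paretoMax_subset _ hy
    exact ⟨x, ⟨hint, hx.trans hle⟩, rfl⟩
  · rintro _ ⟨_, hy₁, _, hy₂, rfl⟩
    obtain ⟨x₁, ⟨hint₁, hx₁⟩, rfl⟩ := paretoMax_subset _ hy₁
    obtain ⟨x₂, ⟨hint₂, hx₂⟩, rfl⟩ := paretoMax_subset _ hy₂
    refine ⟨x₁ + x₂, ⟨fun j => ?_, ?_⟩, Matrix.mulVec_add C x₁ x₂⟩
    · obtain ⟨N₁, h₁⟩ := hint₁ j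
      obtain ⟨N₂, h₂⟩ := hint₂ j
      exact ⟨N₁ + N₂, by simp [h₁, h₂]⟩
    · rw [Matrix.mulVec_add]
      exact add_le_add hx₁ hx₂

end Stmt15
end

section
/- If F is a set-valued function from ℝ^m to subsets of ℝ^k that is feasible to the set-valued superadditive dual (SDP), then for every x ∈ X one has {Cx} ⪯ F(b). -/
open Pointwise

namespace Stmt16

/-- The Pareto set-ordering `S ⪯ T`. -/
def SetPrec {k : ℕ} (S T : Set (Fin k → ℝ)) : Prop :=
  (∀ s ∈ S, ∃ t ∈ T, s ≤ t) ∧ ∀ s ∈ S, ∀ t ∈ T, ¬(t ≤ s ∧ t ≠ s)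

/-- A set-valued function `F : ℝ^m → 2^{ℝ^k}` is feasible to the set-valued superadditive
dual (SDP): each `F v` is a nonempty antichain, `F` is nondecreasing and superadditive
with respect to `⪯`, `0 ∈ F 0`, and `{C_j} ⪯ F(A_j)` for every column `j`. -/
def SDPFeasible {k m n : ℕ} (A : Matrix (Fin m) (Fin n) ℝ) (C : Matrix (Fin k) (Fin n) ℝ)
    (F : (Fin m → ℝ) → Set (Fin k → ℝ)) : Prop :=
  (∀ v, (F v).Nonempty) ∧
  (∀ v, ∀ s ∈ F v, ∀ t ∈ F v, s ≠ t → ¬ s ≤ t ∧ ¬ t ≤ s) ∧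
  (∀ v₁ v₂ : Fin m → ℝ, v₁ ≤ v₂ → SetPrec (F v₁) (F v₂)) ∧
  (∀ v₁ v₂ : Fin m → ℝ, SetPrec (F v₁ + F v₂) (F (v₁ + v₂))) ∧
  (0 ∈ F 0) ∧
  (∀ j : Fin n, SetPrec {fun i => C i j} (F (fun i => A i j)))

/-- Below an antichain, the dominance half of `⪯` for a singleton implies the other half. -/
theorem setPrec_singleton_of_le {k : ℕ} {T : Set (Fin k → ℝ)}
    (hT : ∀ s ∈ T, ∀ t ∈ T, s ≠ t → ¬ s ≤ t ∧ ¬ t ≤ s) {c : Fin k → ℝ}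
    (hc : ∃ t ∈ T, c ≤ t) : SetPrec {c} T := by
  obtain ⟨t, ht, hct⟩ := hc
  refine ⟨fun s hs => ⟨t, ht, hs.le.trans hct⟩, ?_⟩
  rintro s rfl u hu ⟨hus, hne⟩
  obtain rfl : u = t := by
    by_contra h
    exact (hT u hu t ht h).1 (hus.trans hct)
  exact hne (le_antisymm hus hct)

/-- The pairs `(v, c)` such that `c` is dominated by an element of `F v`, as a submonoid. -/
def dominatedSubmonoid {k m : ℕ} (F : (Fin m → ℝ) → Set (Fin k → ℝ)) (h0 : 0 ∈ F 0)
    (hadd : ∀ v₁ v₂ : Fin m → ℝ, SetPrec (F v₁ + F v₂) (F (v₁ + v₂))) :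
    AddSubmonoid ((Fin m → ℝ) × (Fin k → ℝ)) where
  carrier := {p | ∃ t ∈ F p.1, p.2 ≤ t}
  zero_mem' := ⟨0, h0, le_rfl⟩
  add_mem' := by
    rintro ⟨v, c⟩ ⟨w, d⟩ ⟨s, hs, hcs⟩ ⟨t, ht, hdt⟩
    obtain ⟨u, hu, hstu⟩ := (hadd v w).1 (s + t) (Set.add_mem_add hs ht)
    exact ⟨u, hu, (add_le_add hcs hdt).trans hstu⟩

/-- Weak duality for the set-valued superadditive dual: if `F` is SDP-feasible, then
`{Cx} ⪯ F(b)` for every feasible `x`. -/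
theorem sdp_weak_duality {k m n : ℕ}
    (A : Matrix (Fin m) (Fin n) ℝ) (b : Fin m → ℝ) (C : Matrix (Fin k) (Fin n) ℝ)
    (X : Set (Fin n → ℝ))
    (hX : X = {x | (∀ j, ∃ N : ℕ, x j = (N : ℝ)) ∧ A.mulVec x ≤ b})
    (F : (Fin m → ℝ) → Set (Fin k → ℝ)) (hF : SDPFeasible A C F)
    (x : Fin n → ℝ) (hx : x ∈ X) :
    SetPrec {C.mulVec x} (F b) := by
  obtain ⟨-, hanti, hmono, hadd, h0, hcol⟩ := hF
  subst hX
  obtain ⟨hint, hle⟩ := hx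
  choose N hN using hint
  apply setPrec_singleton_of_le (hanti b)
  have hmem : ∑ j, N j • ((fun i => A i j, fun i => C i j) : (Fin m → ℝ) × (Fin k → ℝ)) ∈
      dominatedSubmonoid F h0 hadd :=
    sum_mem fun j _ => nsmul_mem ((hcol j).1 _ rfl) (N j)
  have hsum : ∑ j, N j • ((fun i => A i j, fun i => C i j) : (Fin m → ℝ) × (Fin k → ℝ)) =
      (A.mulVec x, C.mulVec x) := by
    ext i <;> simp [Prod.fst_sum, Prod.snd_sum, Matrix.mulVec, dotProduct, hN, mul_comm]
  rw [hsum] at hmem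
  obtain ⟨s, hs, hcs⟩ := hmem
  obtain ⟨t, ht, hst⟩ := (hmono _ _ hle).1 s hs
  exact ⟨t, ht, hcs.trans hst⟩

end Stmt16
end

section
/- Assume all entries of A and b are rational. Let x* be a supported efficient solution of the MOIP: x* ∈ X, Cx* ∈ Max(Y), and there exists μ ∈ ℝ^k with all components positive such that μᵀCx ≤ μᵀCx* for every x ∈ X. Then there exists a set-valued function F from ℝ^m to subsets of ℝ^k that is feasible to the set-valued superadditive dual (SDP) and satisfies Cx* ∈ F(b). -/
open Matrix Pointwise

namespace Stmt17

/-- Nondominated (from above) points of a subset of ℝ^k. -/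
def ParetoMax {k : ℕ} (S : Set (Fin k → ℝ)) : Set (Fin k → ℝ) :=
  {s ∈ S | ¬ ∃ t ∈ S, s ≤ t ∧ s ≠ t}

/-- The Pareto set-ordering `S ⪯ T`. -/
def SetPrec {k : ℕ} (S T : Set (Fin k → ℝ)) : Prop :=
  (∀ s ∈ S, ∃ t ∈ T, s ≤ t) ∧ ∀ s ∈ S, ∀ t ∈ T, ¬(t ≤ s ∧ t ≠ s)

/-- Feasibility for the set-valued superadditive dual (SDP). -/
def SDPFeasible {k m n : ℕ} (A : Matrix (Fin m) (Fin n) ℝ) (C : Matrix (Fin k) (Fin n) ℝ)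
    (F : (Fin m → ℝ) → Set (Fin k → ℝ)) : Prop :=
  (∀ v, (F v).Nonempty) ∧
  (∀ v, ∀ s ∈ F v, ∀ t ∈ F v, s ≠ t → ¬ s ≤ t ∧ ¬ t ≤ s) ∧
  (∀ v₁ v₂ : Fin m → ℝ, v₁ ≤ v₂ → SetPrec (F v₁) (F v₂)) ∧
  (∀ v₁ v₂ : Fin m → ℝ, SetPrec (F v₁ + F v₂) (F (v₁ + v₂))) ∧
  (0 ∈ F 0) ∧
  (∀ j : Fin n, SetPrec {fun i => C i j} (F (fun i => A i j)))

/-- Bartl's form of Farkas' lemma, for finitely many rational functionals `a i` and a real-valued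
rational-linear functional `c`. -/
theorem exists_nonneg_combination {V ι : Type*} [AddCommGroup V] [Module ℚ V]
    (a : ι → V →ₗ[ℚ] ℚ) (s : Finset ι) (c : V →ₗ[ℚ] ℝ)
    (h : ∀ x, (∀ i ∈ s, a i x ≤ 0) → c x ≤ 0) :
    ∃ u : ι → ℝ, 0 ≤ u ∧ ∀ x, c x = ∑ i ∈ s, (a i x : ℝ) * u i := by
  classical
  induction s using Finset.induction_on generalizing a c with
  | empty =>
    refine ⟨0, le_rfl, fun x => ?_⟩
    have h₁ := h x (by simp)
    have h₂ := h (-x) (by simp)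
    rw [map_neg] at h₂
    simp
    linarith
  | insert k s hk ih =>
    by_cases hs : ∀ x, (∀ i ∈ s, a i x ≤ 0) → c x ≤ 0
    · obtain ⟨u, hu, hcu⟩ := ih a c hs
      refine ⟨Function.update u k 0, fun i => ?_, fun x => ?_⟩
      · by_cases hi : i = k
        · simp [hi]
        · simpa [hi] using hu i
      · rw [hcu x, Finset.sum_insert hk, Function.update_self, mul_zero, zero_add]
        refine Finset.sum_congr rfl fun i hi => ?_
        rw [Function.update_of_ne (ne_of_mem_of_not_mem hi hk)]
    · push Not at hs
      obtain ⟨w, hw, hcw⟩ := hs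
      have hkw : 0 < a k w := by
        by_contra hneg
        refine absurd (h w fun i hi => ?_) (not_le.2 hcw)
        rcases Finset.mem_insert.1 hi with rfl | hi
        · exact not_lt.1 hneg
        · exact hw i hi
      obtain ⟨p, hp, hcp, hkp⟩ : ∃ p, (∀ i ∈ s, a i p ≤ 0) ∧ 0 < c p ∧ a k p = 1 := by
        refine ⟨(a k w)⁻¹ • w, fun i hi => ?_, ?_, ?_⟩
        · rw [map_smul, smul_eq_mul]
          exact mul_nonpos_of_nonneg_of_nonpos (inv_nonneg.2 hkw.le) (hw i hi)
        · rw [map_smul, Rat.smul_def]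
          have : (0 : ℝ) < ((a k w)⁻¹ : ℚ) := by exact_mod_cast inv_pos.2 hkw
          positivity
        · rw [map_smul, smul_eq_mul, inv_mul_cancel₀ hkw.ne']
      let π : V →ₗ[ℚ] V := LinearMap.id - (a k).smulRight p
      have hπ (x : V) : π x = x - a k x • p := rfl
      obtain ⟨u, hu, hcu⟩ := ih (fun i => a i ∘ₗ π) (c ∘ₗ π) fun x hx => by
        refine h (π x) fun i hi => ?_
        rcases Finset.mem_insert.1 hi with rfl | hi
        · simp [hπ, hkp]
        · exact hx i hi
      refine ⟨Function.update u k (c p - ∑ i ∈ s, (a i p : ℝ) * u i), fun i => ?_, fun x => ?_⟩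
      · by_cases hi : i = k
        · subst hi
          rw [Function.update_self, Pi.zero_apply, sub_nonneg]
          refine le_trans (Finset.sum_nonpos fun j hj => ?_) hcp.le
          exact mul_nonpos_of_nonpos_of_nonneg (Rat.cast_nonpos.2 (hp j hj)) (hu j)
        · simpa [hi] using hu i
      · rw [Finset.sum_insert hk, Function.update_self]
        have hsum : ∑ i ∈ s, (a i x : ℝ) *
            Function.update u k (c p - ∑ i ∈ s, (a i p : ℝ) * u i) i =
            ∑ i ∈ s, (a i x : ℝ) * u i :=
          Finset.sum_congr rfl fun i hi => by
            rw [Function.update_of_ne (ne_of_mem_of_not_mem hi hk)]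
        have hx := hcu x
        simp only [LinearMap.comp_apply, hπ, map_sub, map_smul, smul_eq_mul, Rat.smul_def,
          Rat.cast_sub, Rat.cast_mul, sub_mul, Finset.sum_sub_distrib, mul_assoc,
          ← Finset.mul_sum] at hx
        rw [hsum]
        linarith

/-- If a rational system `A x ≤ b` has a natural-number solution at which `c` is maximal, then
the linear programming dual is feasible. -/
theorem exists_dual_feasible {m n : ℕ} (A : Matrix (Fin m) (Fin n) ℝ)
    (hA : ∀ i j, ∃ q : ℚ, A i j = (q : ℝ)) (b : Fin m → ℝ) (c : Fin n → ℝ) (x₀ : Fin n → ℕ)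
    (hx₀ : A *ᵥ (fun j => (x₀ j : ℝ)) ≤ b)
    (hmax : ∀ x : Fin n → ℕ, A *ᵥ (fun j => (x j : ℝ)) ≤ b →
      c ⬝ᵥ (fun j => (x j : ℝ)) ≤ c ⬝ᵥ (fun j => (x₀ j : ℝ))) :
    ∃ u : Fin m → ℝ, 0 ≤ u ∧ c ≤ u ᵥ* A := by
  choose Q hQ using hA
  let a : Fin m ⊕ Fin n → (Fin n → ℚ) →ₗ[ℚ] ℚ :=
    Sum.elim (fun i => ∑ j, Q i j • LinearMap.proj j) (fun j => -LinearMap.proj j)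
  let cl : (Fin n → ℚ) →ₗ[ℚ] ℝ :=
    ∑ j, (LinearMap.proj j : (Fin n → ℚ) →ₗ[ℚ] ℚ).smulRight (c j)
  have hcl (x : Fin n → ℚ) : cl x = ∑ j, (x j : ℝ) * c j := by
    simp [cl, Rat.smul_def]
  have hal (i) (x : Fin n → ℚ) : a (Sum.inl i) x = ∑ j, Q i j * x j := by simp [a]
  have har (j) (x : Fin n → ℚ) : a (Sum.inr j) x = -x j := by simp [a]
  obtain ⟨u, hu, hcu⟩ := exists_nonneg_combination a Finset.univ cl fun x hx => by
    have hx0 (j) : 0 ≤ x j := by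
      have := hx (Sum.inr j) (Finset.mem_univ _)
      rw [har] at this
      linarith
    have hAx (i) : ∑ j, A i j * (x j : ℝ) ≤ 0 := by
      have := hx (Sum.inl i) (Finset.mem_univ _)
      rw [hal] at this
      simp only [hQ]
      exact_mod_cast this
    let D : ℕ := ∏ j, (x j).den
    have hD : 0 < D := Finset.prod_pos fun j _ => (x j).den_pos
    have hN (j) : ∃ N : ℕ, (N : ℝ) = D * (x j : ℝ) := by
      obtain ⟨e, he⟩ : (x j).den ∣ D := Finset.dvd_prod_of_mem _ (Finset.mem_univ j)
      refine ⟨(x j).num.toNat * e, ?_⟩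
      have h₁ : (((x j).num.toNat : ℤ) : ℚ) = (x j).num := by
        rw [Int.toNat_of_nonneg (Rat.num_nonneg.2 (hx0 j))]
      have h₂ : ((x j).num : ℚ) = x j * (x j).den := (Rat.mul_den_eq_num _).symm
      have h₃ : (((x j).num.toNat * e : ℕ) : ℚ) = D * x j := by
        rw [he]
        push_cast at h₁ ⊢
        rw [h₁, h₂]
        ring
      exact_mod_cast h₃
    choose N hN using hN
    have key := hmax (x₀ + N) fun i => by
      refine le_trans ?_ (hx₀ i)
      have hi : ∑ j, A i j * (N j : ℝ) ≤ 0 := by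
        have : ∑ j, A i j * (N j : ℝ) = D * ∑ j, A i j * (x j : ℝ) := by
          rw [Finset.mul_sum]
          exact Finset.sum_congr rfl fun j _ => by rw [hN]; ring
        rw [this]
        exact mul_nonpos_of_nonneg_of_nonpos (Nat.cast_nonneg _) (hAx i)
      simp only [mulVec, dotProduct, Pi.add_apply, Nat.cast_add, mul_add, Finset.sum_add_distrib]
      linarith
    simp only [dotProduct, Pi.add_apply, Nat.cast_add, mul_add, Finset.sum_add_distrib] at key
    have hc : ∑ j, c j * (N j : ℝ) = D * cl x := by
      rw [hcl, Finset.mul_sum]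
      exact Finset.sum_congr rfl fun j _ => by rw [hN]; ring
    have hD' : (0 : ℝ) < D := by exact_mod_cast hD
    by_contra hpos
    have := mul_pos hD' (not_le.1 hpos)
    linarith
  refine ⟨fun i => u (Sum.inl i), fun i => hu _, fun j => ?_⟩
  have hj := hcu (Pi.single j 1)
  have hr : ∑ j', (a (Sum.inr j') (Pi.single j 1) : ℝ) * u (Sum.inr j') = -u (Sum.inr j) := by
    simp [har, Pi.single_apply, apply_ite (Rat.cast : ℚ → ℝ)]
  have hl : ∑ i, (a (Sum.inl i) (Pi.single j 1) : ℝ) * u (Sum.inl i) =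
      ∑ i, u (Sum.inl i) * A i j := by
    refine Finset.sum_congr rfl fun i _ => ?_
    rw [hal, hQ]
    simp [Pi.single_apply, mul_comm]
  rw [Fintype.sum_sum_type, hr, hl, hcl] at hj
  have hcj : ∑ j', ((Pi.single j 1 : Fin n → ℚ) j' : ℝ) * c j' = c j := by
    simp [Pi.single_apply, apply_ite (Rat.cast : ℚ → ℝ)]
  rw [hcj] at hj
  have := hu (Sum.inr j)
  simp only [vecMul, dotProduct]
  simp only [Pi.zero_apply] at this
  linarith

/-- The objective values of `max c x` over `A x ≤ v`, `x` a vector of naturals, where integral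
violations `y` of the constraints are allowed at cost `M` per unit. -/
def penalizedValues {m n : ℕ} (A : Matrix (Fin m) (Fin n) ℝ) (c : Fin n → ℝ) (M : ℝ)
    (v : Fin m → ℝ) : Set ℝ :=
  {r | ∃ (x : Fin n → ℕ) (y : Fin m → ℕ),
    (A *ᵥ (fun j => (x j : ℝ)) ≤ v + fun i => (y i : ℝ)) ∧
    r = c ⬝ᵥ (fun j => (x j : ℝ)) - M * ∑ i, (y i : ℝ)}

theorem penalizedValues_nonempty {m n : ℕ} (A : Matrix (Fin m) (Fin n) ℝ) (c : Fin n → ℝ)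
    (M : ℝ) (v : Fin m → ℝ) : (penalizedValues A c M v).Nonempty := by
  refine ⟨_, 0, fun i => ⌈-v i⌉₊, fun i => ?_, rfl⟩
  have := Nat.le_ceil (-v i)
  simp only [mulVec, dotProduct, Pi.zero_apply, Nat.cast_zero, mul_zero, Finset.sum_const_zero,
    Pi.add_apply]
  linarith

theorem penalized_objective_le {m n : ℕ} {A : Matrix (Fin m) (Fin n) ℝ} {c : Fin n → ℝ}
    {u : Fin m → ℝ} (hu : 0 ≤ u) (hc : c ≤ u ᵥ* A) {v : Fin m → ℝ} (K : ℝ)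
    {x : Fin n → ℕ} {y : Fin m → ℕ}
    (hxy : A *ᵥ (fun j => (x j : ℝ)) ≤ v + fun i => (y i : ℝ)) :
    c ⬝ᵥ (fun j => (x j : ℝ)) - (∑ i, u i + K) * ∑ i, (y i : ℝ) ≤
      u ⬝ᵥ v - K * ∑ i, (y i : ℝ) := by
  have h₁ : c ⬝ᵥ (fun j => (x j : ℝ)) ≤ (u ᵥ* A) ⬝ᵥ (fun j => (x j : ℝ)) :=
    dotProduct_le_dotProduct_of_nonneg_right hc fun j => Nat.cast_nonneg _
  rw [← dotProduct_mulVec] at h₁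
  have h₂ := dotProduct_le_dotProduct_of_nonneg_left hxy hu
  rw [dotProduct_add] at h₂
  have h₃ : u ⬝ᵥ (fun i => (y i : ℝ)) ≤ (∑ i, u i) * ∑ i, (y i : ℝ) := by
    rw [Finset.sum_mul]
    refine Finset.sum_le_sum fun i _ => mul_le_mul_of_nonneg_left ?_ (hu i)
    exact Finset.single_le_sum (f := fun i => (y i : ℝ)) (fun j _ => Nat.cast_nonneg _)
      (Finset.mem_univ i)
  linarith

/-- Strong superadditive duality for a single objective, with a finite-valued dual function. -/
theorem exists_superadditive_dual {m n : ℕ} (A : Matrix (Fin m) (Fin n) ℝ) (b : Fin m → ℝ)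
    (c : Fin n → ℝ) (u : Fin m → ℝ) (hu : 0 ≤ u) (hc : c ≤ u ᵥ* A) (x₀ : Fin n → ℕ)
    (hx₀ : A *ᵥ (fun j => (x₀ j : ℝ)) ≤ b)
    (hmax : ∀ x : Fin n → ℕ, A *ᵥ (fun j => (x j : ℝ)) ≤ b →
      c ⬝ᵥ (fun j => (x j : ℝ)) ≤ c ⬝ᵥ (fun j => (x₀ j : ℝ))) :
    ∃ f : (Fin m → ℝ) → ℝ, Monotone f ∧ (∀ v w, f v + f w ≤ f (v + w)) ∧ f 0 = 0 ∧
      (∀ j, c j ≤ f (fun i => A i j)) ∧ f b = c ⬝ᵥ (fun j => (x₀ j : ℝ)) := by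
  set z := c ⬝ᵥ (fun j => (x₀ j : ℝ)) with hz
  set K := |u ⬝ᵥ b - z| with hK
  have hK0 : 0 ≤ K := abs_nonneg _
  let P := penalizedValues A c (∑ i, u i + K)
  have hne (v) : (P v).Nonempty := penalizedValues_nonempty A c _ v
  have hle (v) : ∀ r ∈ P v, r ≤ u ⬝ᵥ v := by
    rintro r ⟨x, y, hxy, rfl⟩
    have h₁ := penalized_objective_le hu hc K hxy
    have h₂ : 0 ≤ K * ∑ i, (y i : ℝ) := by positivity
    linarith
  have hbdd (v) : BddAbove (P v) := ⟨_, hle v⟩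
  have hmem {v} (x : Fin n → ℕ) (hx : A *ᵥ (fun j => (x j : ℝ)) ≤ v) :
      c ⬝ᵥ (fun j => (x j : ℝ)) ≤ sSup (P v) :=
    le_csSup (hbdd v) ⟨x, 0, fun i => by simpa using hx i, by simp⟩
  refine ⟨fun v => sSup (P v), fun v w hvw => ?_, fun v w => ?_, ?_, fun j => ?_, ?_⟩
  · refine csSup_le_csSup (hbdd w) (hne v) ?_
    rintro r ⟨x, y, hxy, rfl⟩
    exact ⟨x, y, hxy.trans (add_le_add_left hvw _), rfl⟩
  · dsimp only
    rw [← csSup_add (hne v) (hbdd v) (hne w) (hbdd w)]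
    refine csSup_le_csSup (hbdd _) ((hne v).add (hne w)) ?_
    rintro _ ⟨_, ⟨x, y, hxy, rfl⟩, _, ⟨x', y', hxy', rfl⟩, rfl⟩
    refine ⟨x + x', y + y', fun i => ?_, ?_⟩
    · have h₁ := hxy i
      have h₂ := hxy' i
      simp only [mulVec, dotProduct, Pi.add_apply, Nat.cast_add, mul_add,
        Finset.sum_add_distrib] at h₁ h₂ ⊢
      linarith
    · simp only [dotProduct, Pi.add_apply, Nat.cast_add, mul_add, Finset.sum_add_distrib]
      ring
  · refine le_antisymm (csSup_le (hne 0) fun r hr => ?_) ?_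
    · simpa using hle 0 r hr
    · refine le_trans (le_of_eq ?_) (hmem (0 : Fin n → ℕ) fun i => ?_) <;>
        simp [mulVec, dotProduct]
  · have h := hmem (v := fun i => A i j) (Pi.single j 1) fun i => by
      simp [mulVec, dotProduct, Pi.single_apply]
    simpa [dotProduct, Pi.single_apply] using h
  · refine le_antisymm (csSup_le (hne b) ?_) (hmem x₀ hx₀)
    rintro r ⟨x, y, hxy, rfl⟩
    rcases Nat.eq_zero_or_pos (∑ i, y i) with hy | hy
    · have hy0 (i) : y i = 0 := by simpa using Finset.sum_eq_zero_iff.1 hy i (Finset.mem_univ i)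
      have h := hmax x fun i => by simpa [hy0] using hxy i
      simpa [hy0] using h
    · have h₁ := penalized_objective_le hu hc K hxy
      have h₂ : (1 : ℝ) ≤ ∑ i, (y i : ℝ) := by exact_mod_cast hy
      have h₃ : u ⬝ᵥ b - z ≤ K := le_abs_self _
      nlinarith

theorem dotProduct_lt_of_le_of_ne {k : ℕ} {μ s t : Fin k → ℝ} (hμ : ∀ i, 0 < μ i) (hst : s ≤ t)
    (hne : s ≠ t) : μ ⬝ᵥ s < μ ⬝ᵥ t := by
  obtain ⟨i, hi⟩ := Function.ne_iff.1 hne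
  exact Finset.sum_lt_sum (fun j _ => mul_le_mul_of_nonneg_left (hst j) (hμ j).le)
    ⟨i, Finset.mem_univ i, mul_lt_mul_of_pos_left (lt_of_le_of_ne (hst i) hi) (hμ i)⟩

theorem exists_le_dotProduct_eq {k : ℕ} [NeZero k] {μ : Fin k → ℝ} (hμ : ∀ i, 0 < μ i)
    {s : Fin k → ℝ} {r : ℝ} (h : μ ⬝ᵥ s ≤ r) : ∃ t, s ≤ t ∧ μ ⬝ᵥ t = r := by
  refine ⟨s + Pi.single 0 ((r - μ ⬝ᵥ s) / μ 0), ?_, ?_⟩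
  · refine le_add_of_nonneg_right (Pi.single_nonneg.2 ?_)
    exact div_nonneg (sub_nonneg.2 h) (hμ 0).le
  · rw [dotProduct_add, dotProduct_single, mul_div_cancel₀ _ (hμ 0).ne']
    ring

/-- A set on which `μ ⬝ᵥ ·` is at most `r` precedes the hyperplane `μ ⬝ᵥ t = r`. -/
theorem setPrec_hyperplane {k : ℕ} [NeZero k] {μ : Fin k → ℝ} (hμ : ∀ i, 0 < μ i)
    {S : Set (Fin k → ℝ)} {r : ℝ} (h : ∀ s ∈ S, μ ⬝ᵥ s ≤ r) : SetPrec S {t | μ ⬝ᵥ t = r} := by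
  refine ⟨fun s hs => ?_, fun s hs t ht ⟨hts, hne⟩ => ?_⟩
  · obtain ⟨t, hst, ht⟩ := exists_le_dotProduct_eq hμ (h s hs)
    exact ⟨t, ht, hst⟩
  · have := dotProduct_lt_of_le_of_ne hμ hts hne
    have := h s hs
    rw [Set.mem_ofPred_eq] at ht
    linarith

/-- A scalar superadditive dual function for the weighted objective `μ C` yields a set-valued one,
whose values are hyperplanes with normal `μ`. -/
theorem sdpFeasible_hyperplane {k m n : ℕ} [NeZero k] {A : Matrix (Fin m) (Fin n) ℝ}
    {C : Matrix (Fin k) (Fin n) ℝ} {μ : Fin k → ℝ} (hμ : ∀ i, 0 < μ i)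
    {f : (Fin m → ℝ) → ℝ} (hmono : Monotone f) (hadd : ∀ v w, f v + f w ≤ f (v + w))
    (h0 : f 0 = 0) (hcol : ∀ j, (μ ᵥ* C) j ≤ f (fun i => A i j)) :
    SDPFeasible A C fun v => {y | μ ⬝ᵥ y = f v} := by
  refine ⟨fun v => ?_, fun v s hs t ht hne => ⟨fun hle => ?_, fun hle => ?_⟩,
    fun v w hvw => ?_, fun v w => ?_, ?_, fun j => ?_⟩
  · refine ⟨Pi.single 0 (f v / μ 0), ?_⟩
    rw [Set.mem_ofPred_eq, dotProduct_single, mul_div_cancel₀ _ (hμ 0).ne']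
  · exact (dotProduct_lt_of_le_of_ne hμ hle hne).ne (hs.trans ht.symm)
  · exact (dotProduct_lt_of_le_of_ne hμ hle hne.symm).ne (ht.trans hs.symm)
  · exact setPrec_hyperplane hμ fun s hs => (le_of_eq hs).trans (hmono hvw)
  · refine setPrec_hyperplane hμ ?_
    rintro _ ⟨s, hs, t, ht, rfl⟩
    rw [Set.mem_ofPred_eq] at hs ht
    rw [dotProduct_add, hs, ht]
    exact hadd v w
  · simp [h0]
  · refine setPrec_hyperplane hμ ?_
    rintro _ rfl
    exact hcol j

/-- Strong duality for the set-valued superadditive dual at supported efficient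
solutions: there exists an SDP-feasible `F` with `Cx* ∈ F(b)`. -/
theorem sdp_strong_at_supported {k m n : ℕ}
    (A : Matrix (Fin m) (Fin n) ℝ) (b : Fin m → ℝ) (C : Matrix (Fin k) (Fin n) ℝ)
    (hArat : ∀ i j, ∃ q : ℚ, A i j = (q : ℝ)) (hbrat : ∀ i, ∃ q : ℚ, b i = (q : ℝ))
    (X : Set (Fin n → ℝ))
    (hX : X = {x | (∀ j, ∃ N : ℕ, x j = (N : ℝ)) ∧ A.mulVec x ≤ b})
    (Y : Set (Fin k → ℝ)) (hY : Y = (fun x => C.mulVec x) '' X)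
    (xstar : Fin n → ℝ) (hxX : xstar ∈ X) (heff : C.mulVec xstar ∈ ParetoMax Y)
    (μ : Fin k → ℝ) (hμ : ∀ i, 0 < μ i)
    (hsupp : ∀ x ∈ X, μ ⬝ᵥ C.mulVec x ≤ μ ⬝ᵥ C.mulVec xstar) :
    ∃ F : (Fin m → ℝ) → Set (Fin k → ℝ), SDPFeasible A C F ∧ C.mulVec xstar ∈ F b := by
  subst hX hY
  obtain ⟨hnat, hxb⟩ := hxX
  choose x₀ hx₀ using hnat
  obtain rfl : xstar = fun j => (x₀ j : ℝ) := funext hx₀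
  rcases Nat.eq_zero_or_pos k with rfl | hk
  · exact ⟨fun _ => Set.univ,
      ⟨fun _ => Set.univ_nonempty, fun _ s _ t _ hne => absurd (Subsingleton.elim s t) hne,
        fun _ _ _ => ⟨fun s _ => ⟨s, trivial, le_rfl⟩, fun _ _ _ _ h => h.2 (Subsingleton.elim _ _)⟩,
        fun _ _ => ⟨fun s _ => ⟨s, trivial, le_rfl⟩, fun _ _ _ _ h => h.2 (Subsingleton.elim _ _)⟩,
        trivial,
        fun _ => ⟨fun s _ => ⟨s, trivial, le_rfl⟩, fun _ _ _ _ h => h.2 (Subsingleton.elim _ _)⟩⟩,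
      trivial⟩
  · have : NeZero k := ⟨hk.ne'⟩
    have hmax (x : Fin n → ℕ) (hx : A *ᵥ (fun j => (x j : ℝ)) ≤ b) :
        (μ ᵥ* C) ⬝ᵥ (fun j => (x j : ℝ)) ≤ (μ ᵥ* C) ⬝ᵥ (fun j => (x₀ j : ℝ)) := by
      rw [← dotProduct_mulVec, ← dotProduct_mulVec]
      exact hsupp _ ⟨fun j => ⟨x j, rfl⟩, hx⟩
    obtain ⟨u, hu, hc⟩ := exists_dual_feasible A hArat b _ x₀ hxb hmax
    obtain ⟨f, hmono, hadd, h0, hcol, hfb⟩ := exists_superadditive_dual A b _ u hu hc x₀ hxb hmax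
    exact ⟨_, sdpFeasible_hyperplane hμ hmono hadd h0 hcol,
      (dotProduct_mulVec _ _ _).trans hfb.symm⟩

end Stmt17
end

section
/- If F = (f_1, …, f_k) is feasible to the vector-valued superadditive dual (VSDP), then Cx ≤ F(b) for every x ∈ X, i.e., (Cx)_i ≤ f_i(b) for every i ∈ {1, …, k} and every x ∈ X. -/
namespace Stmt18

/-- Feasibility for the vector-valued superadditive dual (VSDP): each component function
is nondecreasing, superadditive, vanishes at 0, and dominates the corresponding row of `C`
on the columns of `A`. -/
def VSDPFeasible {k m n : ℕ} (A : Matrix (Fin m) (Fin n) ℝ)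
    (C : Matrix (Fin k) (Fin n) ℝ) (f : Fin k → (Fin m → ℝ) → ℝ) : Prop :=
  ∀ i : Fin k,
    (∀ v₁ v₂ : Fin m → ℝ, v₁ ≤ v₂ → f i v₁ ≤ f i v₂) ∧
    (∀ v₁ v₂ : Fin m → ℝ, f i v₁ + f i v₂ ≤ f i (v₁ + v₂)) ∧
    f i 0 = 0 ∧
    (∀ j : Fin n, C i j ≤ f i (fun r => A r j))

/-- A superadditive function with `g 0 = 0` satisfies `N * g v ≤ g (N • v)`. -/
theorem natCast_mul_le_of_superadditive {V : Type*} [AddCommMonoid V] {g : V → ℝ}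
    (hadd : ∀ v w, g v + g w ≤ g (v + w)) (hzero : g 0 = 0) (N : ℕ) (v : V) :
    (N : ℝ) * g v ≤ g (N • v) := by
  induction N with
  | zero => simp [hzero]
  | succ N ih =>
    rw [succ_nsmul]
    push_cast
    linarith [hadd (N • v) v]

/-- A superadditive function with `g 0 = 0` is superadditive on finite sums. -/
theorem sum_le_of_superadditive {V ι : Type*} [AddCommMonoid V] {g : V → ℝ}
    (hadd : ∀ v w, g v + g w ≤ g (v + w)) (hzero : g 0 = 0) (s : Finset ι) (u : ι → V) :
    ∑ j ∈ s, g (u j) ≤ g (∑ j ∈ s, u j) := by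
  classical
  induction s using Finset.induction_on with
  | empty => simp [hzero]
  | insert a s ha ih =>
    rw [Finset.sum_insert ha, Finset.sum_insert ha]
    linarith [hadd (u a) (∑ j ∈ s, u j)]

/-- Weak duality for the vector-valued superadditive dual: if `F = (f_1, …, f_k)` is
VSDP-feasible, then `Cx ≤ F(b)` componentwise for every feasible `x`. -/
theorem vsdp_weak_duality {k m n : ℕ}
    (A : Matrix (Fin m) (Fin n) ℝ) (b : Fin m → ℝ) (C : Matrix (Fin k) (Fin n) ℝ)
    (X : Set (Fin n → ℝ))
    (hX : X = {x | (∀ j, ∃ N : ℕ, x j = (N : ℝ)) ∧ A.mulVec x ≤ b})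
    (f : Fin k → (Fin m → ℝ) → ℝ) (hf : VSDPFeasible A C f)
    (x : Fin n → ℝ) (hx : x ∈ X) :
    C.mulVec x ≤ fun i => f i b := by
  subst hX
  obtain ⟨hint, hAx⟩ := hx
  choose N hN using hint
  intro i
  obtain ⟨hmono, hadd, hzero, hcol⟩ := hf i
  have hsum : ∑ j, N j • (fun r => A r j) = A.mulVec x := by
    ext r
    simp [Matrix.mulVec, dotProduct, hN, mul_comm]
  calc C.mulVec x i = ∑ j, (N j : ℝ) * C i j := by
        simp [Matrix.mulVec, dotProduct, hN, mul_comm]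
    _ ≤ ∑ j, (N j : ℝ) * f i (fun r => A r j) := by
        gcongr with j
        exact hcol j
    _ ≤ ∑ j, f i (N j • fun r => A r j) :=
        Finset.sum_le_sum fun j _ => natCast_mul_le_of_superadditive hadd hzero _ _
    _ ≤ f i (∑ j, N j • fun r => A r j) := sum_le_of_superadditive hadd hzero _ _
    _ = f i (A.mulVec x) := by rw [hsum]
    _ ≤ f i b := hmono _ _ hAx

end Stmt18
end

section
/- Assume all entries of A and b are rational, Y is nonempty, and every element of Y is dominated by some element of Max(Y), i.e., for each y ∈ Y there is z ∈ Max(Y) with y ≤ z (this holds, e.g., when X is finite). Then the vector-valued superadditive dual is strong if and only if the MOIP has a unique nondominated point; that is, there exists a VSDP-feasible tuple F with F(b) ∈ Max(Y) if and only if Max(Y) is a singleton. -/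
namespace Stmt19

/-- Nondominated (from above) points of a subset of ℝ^k. -/
def ParetoMax {k : ℕ} (S : Set (Fin k → ℝ)) : Set (Fin k → ℝ) :=
  {s ∈ S | ¬ ∃ t ∈ S, s ≤ t ∧ s ≠ t}

/-- Feasibility for the vector-valued superadditive dual (VSDP). -/
def VSDPFeasible {k m n : ℕ} (A : Matrix (Fin m) (Fin n) ℝ)
    (C : Matrix (Fin k) (Fin n) ℝ) (f : Fin k → (Fin m → ℝ) → ℝ) : Prop :=
  ∀ i : Fin k,
    (∀ v₁ v₂ : Fin m → ℝ, v₁ ≤ v₂ → f i v₁ ≤ f i v₂) ∧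
    (∀ v₁ v₂ : Fin m → ℝ, f i v₁ + f i v₂ ≤ f i (v₁ + v₂)) ∧
    f i 0 = 0 ∧
    (∀ j : Fin n, C i j ≤ f i (fun r => A r j))

/-- A mixed-field **Farkas lemma**: the constraint functionals take values in an ordered subfield
(here `ℚ`), the implied functional takes values in `ℝ`. -/
lemma farkas_rat_real {V ι : Type*} [AddCommGroup V] [Module ℚ V] [DecidableEq ι]
    (s : Finset ι) (a : ι → V →ₗ[ℚ] ℚ) (c : V →ₗ[ℚ] ℝ)
    (h : ∀ x, (∀ i ∈ s, a i x ≤ 0) → c x ≤ 0) :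
    ∃ u : ι → ℝ, (∀ i, 0 ≤ u i) ∧ ∀ x, c x = ∑ i ∈ s, u i * (a i x : ℝ) := by
  induction s using Finset.induction_on generalizing a c with
  | empty =>
    refine ⟨0, fun _ => le_rfl, fun x => ?_⟩
    have h₁ := h x (by simp)
    have h₂ := h (-x) (by simp)
    rw [map_neg] at h₂
    simp only [Finset.sum_empty]
    linarith
  | insert k s hk ih =>
    by_cases hs : ∀ x, (∀ i ∈ s, a i x ≤ 0) → c x ≤ 0
    · obtain ⟨u, hu, hc⟩ := ih a c hs
      refine ⟨Function.update u k 0, fun i => ?_, fun x => ?_⟩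
      · by_cases hi : i = k
        · simp [hi]
        · simp [hi, hu i]
      · rw [Finset.sum_insert hk, hc x]
        simp only [Function.update_self, zero_mul, zero_add]
        refine Finset.sum_congr rfl fun i hi => ?_
        rw [Function.update_of_ne (ne_of_mem_of_not_mem hi hk)]
    · push Not at hs
      obtain ⟨y, hy, hcy⟩ := hs
      have hky : 0 < a k y := by
        by_contra hle
        exact absurd (h y (by simpa [hy] using ⟨not_lt.mp hle, hy⟩)) (not_le.mpr hcy)
      obtain ⟨e, he, hce, hke⟩ : ∃ e, (∀ i ∈ s, a i e ≤ 0) ∧ 0 < c e ∧ a k e = 1 := by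
        refine ⟨(a k y)⁻¹ • y, fun i hi => ?_, ?_, ?_⟩
        · rw [map_smul, smul_eq_mul]
          exact mul_nonpos_of_nonneg_of_nonpos (inv_nonneg.mpr hky.le) (hy i hi)
        · rw [map_smul]
          exact smul_pos (inv_pos.mpr hky) hcy
        · rw [map_smul, smul_eq_mul, inv_mul_cancel₀ hky.ne']
      obtain ⟨u, hu, hc⟩ := ih (fun i => a i - a i e • a k)
        (c - (LinearMap.toSpanSingleton ℚ ℝ (c e)).comp (a k)) (fun x hx => by
          have := h (x - a k x • e) (fun i hi => by
            rcases Finset.mem_insert.mp hi with rfl | hi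
            · simp [hke]
            · have := hx i hi
              simp only [LinearMap.sub_apply, LinearMap.smul_apply, smul_eq_mul] at this
              simp only [map_sub, map_smul, smul_eq_mul]
              linarith)
          simpa using this)
      have hnonneg : 0 ≤ c e - ∑ i ∈ s, u i * (a i e : ℝ) := by
        have : ∑ i ∈ s, u i * (a i e : ℝ) ≤ 0 := Finset.sum_nonpos fun i hi =>
          mul_nonpos_of_nonneg_of_nonpos (hu i) (by exact_mod_cast he i hi)
        linarith
      refine ⟨Function.update u k (c e - ∑ i ∈ s, u i * (a i e : ℝ)), fun i => ?_, fun x => ?_⟩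
      · by_cases hi : i = k
        · simpa [hi] using hnonneg
        · simp [hi, hu i]
      · have hx := hc x
        rw [Finset.sum_insert hk, Function.update_self]
        have hsum : ∑ i ∈ s, Function.update u k (c e - ∑ i ∈ s, u i * (a i e : ℝ)) i *
            (a i x : ℝ) = ∑ i ∈ s, u i * (a i x : ℝ) :=
          Finset.sum_congr rfl fun i hi => by
            rw [Function.update_of_ne (ne_of_mem_of_not_mem hi hk)]
        rw [hsum]
        simp only [LinearMap.sub_apply, LinearMap.comp_apply, LinearMap.toSpanSingleton_apply,
          LinearMap.smul_apply, smul_eq_mul, Rat.smul_def, Rat.cast_sub, Rat.cast_mul, mul_sub,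
          Finset.sum_sub_distrib] at hx
        have hmul : ∑ i ∈ s, u i * ((a i e : ℝ) * (a k x : ℝ)) =
            (∑ i ∈ s, u i * (a i e : ℝ)) * (a k x : ℝ) := by
          rw [Finset.sum_mul]
          exact Finset.sum_congr rfl fun i _ => by ring
        rw [hmul] at hx
        linear_combination hx

lemma exists_common_denominator {ι : Type*} [Fintype ι] (q : ι → ℚ) :
    ∃ D : ℕ, 0 < D ∧ ∀ i, ∃ z : ℤ, (D : ℚ) * q i = z := by
  refine ⟨∏ i, (q i).den, Finset.prod_pos fun i _ => (q i).den_pos, fun i => ?_⟩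
  obtain ⟨e, he⟩ := Finset.dvd_prod_of_mem (fun i => (q i).den) (Finset.mem_univ i)
  refine ⟨e * (q i).num, ?_⟩
  rw [he]
  push_cast
  linear_combination (e : ℚ) * Rat.den_mul_eq_num (q i)

/-- A bounded feasible integer program with rational constraint matrix has a dual feasible
multiplier vector for its linear relaxation. -/
lemma exists_dual_multiplier {m n : ℕ} (A : Matrix (Fin m) (Fin n) ℝ) (b : Fin m → ℝ)
    (c : Fin n → ℝ) (hA : ∀ i j, ∃ q : ℚ, A i j = q) (x₀ : Fin n → ℕ)
    (hx₀ : A.mulVec (fun j => (x₀ j : ℝ)) ≤ b)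
    (hmax : ∀ x : Fin n → ℕ, A.mulVec (fun j => (x j : ℝ)) ≤ b →
      ∑ j, c j * (x j : ℝ) ≤ ∑ j, c j * (x₀ j : ℝ)) :
    ∃ u : Fin m → ℝ, (∀ i, 0 ≤ u i) ∧ ∀ j, c j ≤ ∑ i, u i * A i j := by
  choose Q hQ using hA
  let a : Fin m ⊕ Fin n → (Fin n → ℚ) →ₗ[ℚ] ℚ :=
    Sum.elim (fun i => ∑ j, Q i j • LinearMap.proj j) (fun j => -LinearMap.proj j)
  let cl : (Fin n → ℚ) →ₗ[ℚ] ℝ :=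
    ∑ j, (LinearMap.toSpanSingleton ℚ ℝ (c j)).comp (LinearMap.proj j)
  have ha : ∀ i x, a (Sum.inl i) x = ∑ j, Q i j * x j := fun i x => by simp [a]
  have hcl : ∀ x, cl x = ∑ j, c j * (x j : ℝ) := fun x => by
    simp [cl, Rat.smul_def, mul_comm]
  have hray : ∀ x, (∀ i ∈ Finset.univ, a i x ≤ 0) → cl x ≤ 0 := by
    intro x hx
    have hx0 : ∀ j, 0 ≤ x j := fun j => by simpa [a] using hx (Sum.inr j) (Finset.mem_univ _)
    obtain ⟨D, hD, hDx⟩ := exists_common_denominator x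
    have hnat : ∀ j, ∃ N : ℕ, (N : ℚ) = D * x j := fun j => by
      obtain ⟨z, hz⟩ := hDx j
      have hz0 : 0 ≤ z := by
        have : (0 : ℚ) ≤ z := hz ▸ mul_nonneg D.cast_nonneg (hx0 j)
        exact_mod_cast this
      lift z to ℕ using hz0
      exact ⟨z, by simpa using hz.symm⟩
    choose N hN using hnat
    have hNr : ∀ j, (N j : ℝ) = D * (x j : ℝ) := fun j => by
      exact_mod_cast congrArg (Rat.cast (K := ℝ)) (hN j)
    by_contra! hpos
    obtain ⟨t, ht⟩ := Archimedean.arch (1 : ℝ) (mul_pos (Nat.cast_pos.mpr hD) hpos)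
    have hfeas : A.mulVec (fun j => ((x₀ j + t * N j : ℕ) : ℝ)) ≤ b := by
      intro i
      refine le_trans ?_ (hx₀ i)
      have hi := hx (Sum.inl i) (Finset.mem_univ _)
      rw [ha] at hi
      have hi' : ∑ j, A i j * (x j : ℝ) ≤ 0 := by
        simp only [hQ]
        exact_mod_cast hi
      have : A.mulVec (fun j => ((x₀ j + t * N j : ℕ) : ℝ)) i =
          A.mulVec (fun j => (x₀ j : ℝ)) i + t * D * ∑ j, A i j * (x j : ℝ) := by
        simp only [Matrix.mulVec, dotProduct, Finset.mul_sum, ← Finset.sum_add_distrib]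
        refine Finset.sum_congr rfl fun j _ => ?_
        push_cast
        rw [hNr]
        ring
      rw [this]
      have := mul_nonpos_of_nonneg_of_nonpos (show (0 : ℝ) ≤ t * D by positivity) hi'
      linarith
    have hle := hmax _ hfeas
    have : ∑ j, c j * ((x₀ j + t * N j : ℕ) : ℝ) = ∑ j, c j * (x₀ j : ℝ) + t * (D * cl x) := by
      rw [hcl]
      simp only [Finset.mul_sum, ← Finset.sum_add_distrib]
      refine Finset.sum_congr rfl fun j _ => ?_
      push_cast
      rw [hNr]
      ring
    rw [nsmul_eq_mul] at ht
    linarith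
  obtain ⟨u, hu, hc⟩ := farkas_rat_real Finset.univ a cl hray
  refine ⟨fun i => u (Sum.inl i), fun i => hu _, fun j => ?_⟩
  have hj := hc (Pi.single j 1)
  rw [hcl, Fintype.sum_sum_type] at hj
  have h₁ : ∑ l, c l * ((Pi.single j (1 : ℚ) : Fin n → ℚ) l : ℝ) = c j := by
    rw [Finset.sum_eq_single j] <;> simp +contextual
  have h₂ : ∑ i, u (Sum.inl i) * (a (Sum.inl i) (Pi.single j 1) : ℝ) =
      ∑ i, u (Sum.inl i) * A i j :=
    Finset.sum_congr rfl fun i _ => by rw [ha, hQ]; simp [Pi.single_apply]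
  have h₃ : ∑ l, u (Sum.inr l) * (a (Sum.inr l) (Pi.single j 1) : ℝ) ≤ 0 :=
    Finset.sum_nonpos fun l _ => mul_nonpos_of_nonneg_of_nonpos (hu _) (by
      simp only [a, Sum.elim_inr, LinearMap.neg_apply, LinearMap.proj_apply, Pi.single_apply]
      split_ifs <;> norm_num)
  linarith

/-- The objective value of `x` minus `M` times the total violation of `A x ≤ v`. -/
def penalized {m n : ℕ} (A : Matrix (Fin m) (Fin n) ℝ) (c : Fin n → ℝ) (M : ℝ)
    (v : Fin m → ℝ) (x : Fin n → ℕ) : ℝ :=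
  ∑ j, c j * (x j : ℝ) - M * ∑ i, max (A.mulVec (fun j => (x j : ℝ)) i - v i) 0

section penalized

variable {m n : ℕ} {A : Matrix (Fin m) (Fin n) ℝ} {c : Fin n → ℝ} {M : ℝ}

lemma penalized_of_feasible {v : Fin m → ℝ} {x : Fin n → ℕ}
    (hx : A.mulVec (fun j => (x j : ℝ)) ≤ v) :
    penalized A c M v x = ∑ j, c j * (x j : ℝ) := by
  have : ∑ i, max (A.mulVec (fun j => (x j : ℝ)) i - v i) 0 = 0 :=
    Finset.sum_eq_zero fun i _ => max_eq_right (sub_nonpos.mpr (hx i))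
  rw [penalized, this, mul_zero, sub_zero]

lemma penalized_mono (hM : 0 ≤ M) {v w : Fin m → ℝ} (hvw : v ≤ w) (x : Fin n → ℕ) :
    penalized A c M v x ≤ penalized A c M w x := by
  unfold penalized
  gcongr
  exact hvw _

lemma penalized_add_le (hM : 0 ≤ M) (v w : Fin m → ℝ) (x y : Fin n → ℕ) :
    penalized A c M v x + penalized A c M w y ≤ penalized A c M (v + w) (x + y) := by
  have hA : A.mulVec (fun j => ((x + y) j : ℝ)) =
      A.mulVec (fun j => (x j : ℝ)) + A.mulVec (fun j => (y j : ℝ)) := by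
    rw [← Matrix.mulVec_add]
    congr 1
    ext j
    simp
  have hc : ∑ j, c j * ((x + y) j : ℝ) = ∑ j, c j * (x j : ℝ) + ∑ j, c j * (y j : ℝ) := by
    simp [mul_add, Finset.sum_add_distrib]
  have hp : ∑ i, max (A.mulVec (fun j => ((x + y) j : ℝ)) i - (v + w) i) 0 ≤
      ∑ i, max (A.mulVec (fun j => (x j : ℝ)) i - v i) 0 +
        ∑ i, max (A.mulVec (fun j => (y j : ℝ)) i - w i) 0 := by
    rw [← Finset.sum_add_distrib, hA]
    refine Finset.sum_le_sum fun i _ => ?_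
    simp only [Pi.add_apply]
    refine max_le ?_ (by positivity)
    linarith [le_max_left (A.mulVec (fun j => (x j : ℝ)) i - v i) 0,
      le_max_left (A.mulVec (fun j => (y j : ℝ)) i - w i) 0]
  have := mul_le_mul_of_nonneg_left hp hM
  unfold penalized
  linarith

lemma sum_mul_le_dual {u : Fin m → ℝ} (hu : ∀ i, 0 ≤ u i) (hc : ∀ j, c j ≤ ∑ i, u i * A i j)
    (v : Fin m → ℝ) (x : Fin n → ℕ) :
    ∑ j, c j * (x j : ℝ) ≤ ∑ i, u i * v i +
      (∑ i, u i) * ∑ i, max (A.mulVec (fun j => (x j : ℝ)) i - v i) 0 := by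
  calc ∑ j, c j * (x j : ℝ) ≤ ∑ j, (∑ i, u i * A i j) * (x j : ℝ) := by
        gcongr with j
        exact hc j
    _ = ∑ i, u i * A.mulVec (fun j => (x j : ℝ)) i := by
        simp only [Matrix.mulVec, dotProduct, Finset.sum_mul, Finset.mul_sum]
        rw [Finset.sum_comm]
        simp only [mul_assoc]
    _ ≤ ∑ i, (u i * v i +
          (∑ l, u l) * max (A.mulVec (fun j => (x j : ℝ)) i - v i) 0) := by
        refine Finset.sum_le_sum fun i _ => ?_
        have h₁ : u i ≤ ∑ l, u l :=
          Finset.single_le_sum (fun l _ => hu l) (Finset.mem_univ i)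
        have h₂ := mul_le_mul_of_nonneg_left
          (le_max_left (A.mulVec (fun j => (x j : ℝ)) i - v i) 0) (hu i)
        have h₃ := mul_le_mul_of_nonneg_right h₁
          (le_max_right (A.mulVec (fun j => (x j : ℝ)) i - v i) 0)
        linarith
    _ = _ := by rw [Finset.sum_add_distrib, Finset.mul_sum]

end penalized

/-- Strong superadditive duality for a single-objective integer program attaining its maximum,
with a dual function that is finite on all of `ℝ^m`. -/
theorem exists_superadditive_dual {m n : ℕ} (A : Matrix (Fin m) (Fin n) ℝ) (b : Fin m → ℝ)
    (c : Fin n → ℝ) (hA : ∀ i j, ∃ q : ℚ, A i j = q) (hb : ∀ i, ∃ q : ℚ, b i = q)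
    (x₀ : Fin n → ℕ) (hx₀ : A.mulVec (fun j => (x₀ j : ℝ)) ≤ b)
    (hmax : ∀ x : Fin n → ℕ, A.mulVec (fun j => (x j : ℝ)) ≤ b →
      ∑ j, c j * (x j : ℝ) ≤ ∑ j, c j * (x₀ j : ℝ)) :
    ∃ f : (Fin m → ℝ) → ℝ,
      (∀ v₁ v₂, v₁ ≤ v₂ → f v₁ ≤ f v₂) ∧ (∀ v₁ v₂, f v₁ + f v₂ ≤ f (v₁ + v₂)) ∧
      f 0 = 0 ∧ (∀ j, c j ≤ f (fun r => A r j)) ∧ f b = ∑ j, c j * (x₀ j : ℝ) := by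
  obtain ⟨u, hu, huc⟩ := exists_dual_multiplier A b c hA x₀ hx₀ hmax
  choose Q hQ using hA
  choose q hq using hb
  obtain ⟨D, hD, hDint⟩ := exists_common_denominator
    (Sum.elim (fun p : Fin m × Fin n => Q p.1 p.2) q)
  have hDr : (0 : ℝ) < D := Nat.cast_pos.mpr hD
  set z := ∑ j, c j * (x₀ j : ℝ)
  have hzub : z ≤ ∑ i, u i * b i := by
    have h := sum_mul_le_dual hu huc b x₀
    have h0 : ∑ i, max (A.mulVec (fun j => (x₀ j : ℝ)) i - b i) 0 = 0 :=
      Finset.sum_eq_zero fun i _ => max_eq_right (sub_nonpos.mpr (hx₀ i))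
    rwa [h0, mul_zero, add_zero] at h
  set M := ∑ i, u i + D * (∑ i, u i * b i - z) with hMdef
  have hgap : 0 ≤ D * (∑ i, u i * b i - z) := mul_nonneg hDr.le (sub_nonneg.mpr hzub)
  have hM : 0 ≤ M := add_nonneg (Finset.sum_nonneg fun i _ => hu i) hgap
  have hviol : ∀ (v : Fin m → ℝ) (x : Fin n → ℕ),
      0 ≤ ∑ i, max (A.mulVec (fun j => (x j : ℝ)) i - v i) 0 :=
    fun v x => Finset.sum_nonneg fun i _ => le_max_right _ _
  have hbound : ∀ v x, penalized A c M v x ≤ ∑ i, u i * v i := fun v x => by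
    have h₁ := sum_mul_le_dual hu huc v x
    have h₂ := mul_nonneg hgap (hviol v x)
    unfold penalized
    rw [hMdef, add_mul]
    linarith
  have hbdd : ∀ v, BddAbove (Set.range (penalized A c M v)) := fun v =>
    ⟨_, Set.forall_mem_range.mpr (hbound v)⟩
  have hexact : ∀ x, penalized A c M b x ≤ z := by
    intro x
    by_cases hx : A.mulVec (fun j => (x j : ℝ)) ≤ b
    · rw [penalized_of_feasible hx]
      exact hmax x hx
    · simp only [Pi.le_def, not_forall, not_le] at hx
      obtain ⟨i, hi⟩ := hx
      have hint : ∃ w : ℤ, (D : ℝ) * (A.mulVec (fun j => (x j : ℝ)) i - b i) = w := by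
        obtain ⟨wb, hwb⟩ := hDint (Sum.inr i)
        choose w hw using fun j => hDint (Sum.inl (i, j))
        simp only [Sum.elim_inl, Sum.elim_inr] at hw hwb
        have hw' : ∀ j, (D : ℝ) * A i j = w j := fun j => by
          rw [hQ]
          exact_mod_cast congrArg (Rat.cast (K := ℝ)) (hw j)
        have hwb' : (D : ℝ) * b i = wb := by
          rw [hq]
          exact_mod_cast congrArg (Rat.cast (K := ℝ)) hwb
        refine ⟨∑ j, w j * (x j : ℤ) - wb, ?_⟩
        push_cast
        simp only [mul_sub, hwb', Matrix.mulVec, dotProduct, Finset.mul_sum, ← mul_assoc, hw']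
      have hone : 1 ≤ (D : ℝ) * (A.mulVec (fun j => (x j : ℝ)) i - b i) := by
        obtain ⟨w, hw⟩ := hint
        have : (0 : ℝ) < w := hw ▸ mul_pos hDr (sub_pos.mpr hi)
        rw [hw]
        exact_mod_cast this
      have hle : A.mulVec (fun j => (x j : ℝ)) i - b i ≤
          ∑ i, max (A.mulVec (fun j => (x j : ℝ)) i - b i) 0 :=
        (le_max_left _ 0).trans (Finset.single_le_sum
          (f := fun i => max (A.mulVec (fun j => (x j : ℝ)) i - b i) 0)
          (fun _ _ => le_max_right _ _) (Finset.mem_univ i))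
      have h₁ := sum_mul_le_dual hu huc b x
      have h₂ := mul_le_mul_of_nonneg_right
        (hone.trans (mul_le_mul_of_nonneg_left hle hDr.le)) (sub_nonneg.mpr hzub)
      unfold penalized
      rw [hMdef, add_mul]
      linarith
  have hle : ∀ v x, penalized A c M v x ≤ ⨆ y, penalized A c M v y := fun v =>
    le_ciSup (hbdd v)
  refine ⟨fun v => ⨆ x, penalized A c M v x, fun v w hvw => ?_, fun v w => ?_, ?_, fun j => ?_, ?_⟩
  · exact ciSup_mono (hbdd w) (penalized_mono hM hvw)
  · exact ciSup_add_ciSup_le fun x y => (penalized_add_le hM v w x y).trans (hle _ _)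
  · refine le_antisymm (ciSup_le fun x => by simpa using hbound 0 x) ?_
    refine le_trans (le_of_eq ?_) (hle 0 0)
    simp [penalized, Matrix.mulVec, dotProduct]
  · refine le_trans (le_of_eq ?_) (hle _ (Pi.single j 1))
    have hcol : A.mulVec (fun l => ((Pi.single j 1 : Fin n → ℕ) l : ℝ)) = fun r => A r j := by
      ext r
      simp [Matrix.mulVec, dotProduct, Pi.single_apply]
    rw [penalized_of_feasible hcol.le]
    simp [Pi.single_apply]
  · refine le_antisymm (ciSup_le hexact) ?_
    exact (penalized_of_feasible hx₀).symm.le.trans (hle b x₀)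

/-- Weak superadditive duality. -/
lemma sum_mul_le_of_superadditive {m n : ℕ} {A : Matrix (Fin m) (Fin n) ℝ} {b : Fin m → ℝ}
    {c : Fin n → ℝ} {f : (Fin m → ℝ) → ℝ} (hmono : ∀ v₁ v₂, v₁ ≤ v₂ → f v₁ ≤ f v₂)
    (hsup : ∀ v₁ v₂, f v₁ + f v₂ ≤ f (v₁ + v₂)) (h0 : f 0 = 0)
    (hc : ∀ j, c j ≤ f (fun r => A r j)) {x : Fin n → ℕ}
    (hx : A.mulVec (fun j => (x j : ℝ)) ≤ b) :
    ∑ j, c j * (x j : ℝ) ≤ f b := by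
  have hnsmul : ∀ (N : ℕ) v, N * f v ≤ f ((N : ℝ) • v) := fun N v => by
    induction N with
    | zero => simp [h0]
    | succ N ih =>
      have := hsup ((N : ℝ) • v) v
      push_cast
      rw [add_smul, one_smul]
      linarith
  have hsum : ∀ (s : Finset (Fin n)) (v : Fin n → Fin m → ℝ),
      ∑ j ∈ s, f (v j) ≤ f (∑ j ∈ s, v j) := fun s v => by
    classical
    induction s using Finset.induction_on with
    | empty => simp [h0]
    | insert k s hk ih =>
      rw [Finset.sum_insert hk, Finset.sum_insert hk]
      linarith [hsup (v k) (∑ j ∈ s, v j)]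
  calc ∑ j, c j * (x j : ℝ) ≤ ∑ j, f ((x j : ℝ) • fun r => A r j) := by
        refine Finset.sum_le_sum fun j _ => le_trans ?_ (hnsmul _ _)
        rw [mul_comm]
        exact mul_le_mul_of_nonneg_left (hc j) (x j).cast_nonneg
    _ ≤ f (∑ j, (x j : ℝ) • fun r => A r j) := hsum _ _
    _ ≤ f b := by
        refine hmono _ _ (le_trans (le_of_eq ?_) hx)
        ext r
        simp [Matrix.mulVec, dotProduct, mul_comm]

/-- The vector-valued superadditive dual is strong if and only if the MOIP has a unique
nondominated point. -/
theorem vsdp_strong_iff_unique_nondominated {k m n : ℕ}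
    (A : Matrix (Fin m) (Fin n) ℝ) (b : Fin m → ℝ) (C : Matrix (Fin k) (Fin n) ℝ)
    (hArat : ∀ i j, ∃ q : ℚ, A i j = (q : ℝ)) (hbrat : ∀ i, ∃ q : ℚ, b i = (q : ℝ))
    (X : Set (Fin n → ℝ))
    (hX : X = {x | (∀ j, ∃ N : ℕ, x j = (N : ℝ)) ∧ A.mulVec x ≤ b})
    (Y : Set (Fin k → ℝ)) (hY : Y = (fun x => C.mulVec x) '' X)
    (hYne : Y.Nonempty)
    (hdom : ∀ y ∈ Y, ∃ z ∈ ParetoMax Y, y ≤ z) :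
    (∃ f : Fin k → (Fin m → ℝ) → ℝ, VSDPFeasible A C f ∧
        (fun i => f i b) ∈ ParetoMax Y)
      ↔ ∃ z : Fin k → ℝ, ParetoMax Y = {z} := by
  have hYmem : ∀ y, y ∈ Y ↔ ∃ x : Fin n → ℕ, A.mulVec (fun j => (x j : ℝ)) ≤ b ∧
      C.mulVec (fun j => (x j : ℝ)) = y := by
    intro y
    rw [hY, hX]
    constructor
    · rintro ⟨x, ⟨hx, hxb⟩, rfl⟩
      choose N hN using hx
      obtain rfl : x = fun j => (N j : ℝ) := funext hN
      exact ⟨N, hxb, rfl⟩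
    · rintro ⟨x, hx, rfl⟩
      exact ⟨_, ⟨fun j => ⟨x j, rfl⟩, hx⟩, rfl⟩
  constructor
  · rintro ⟨f, hf, hfb⟩
    refine ⟨fun i => f i b, Set.eq_singleton_iff_unique_mem.mpr ⟨hfb, fun y hy => ?_⟩⟩
    by_contra hne
    obtain ⟨x, hx, rfl⟩ := (hYmem y).mp hy.1
    refine hy.2 ⟨_, hfb.1, fun i => ?_, hne⟩
    obtain ⟨hmono, hsup, h0, hc⟩ := hf i
    exact sum_mul_le_of_superadditive hmono hsup h0 hc hx
  · rintro ⟨z, hz⟩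
    have hzmem : z ∈ ParetoMax Y := hz ▸ rfl
    obtain ⟨x₀, hx₀, hCx₀⟩ := (hYmem z).mp hzmem.1
    have hle : ∀ y ∈ Y, y ≤ z := fun y hy => by
      obtain ⟨w, hw, hyw⟩ := hdom y hy
      rw [hz] at hw
      exact hyw.trans_eq hw
    choose f hmono hsup h0 hc hfb using fun i =>
      exists_superadditive_dual A b (C i) hArat hbrat x₀ hx₀ fun x hx => by
        have := hle _ ((hYmem _).mpr ⟨x, hx, rfl⟩) i
        rwa [← hCx₀] at this
    refine ⟨f, fun i => ⟨hmono i, hsup i, h0 i, hc i⟩, ?_⟩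
    have : (fun i => f i b) = z := by
      rw [← hCx₀]
      exact funext hfb
    rwa [this]

end Stmt19
end
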